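/- arXiv:math/0311512 — 3 statements merged into one kernel-verified Lean document; each statement's English description precedes it below -/
import Mathlib

section
/- There is a (unique) algebra homomorphism ρ = ρ(κ,κ_1)_σ : 𝒜 → End_ℂ(V(κ,κ_1)) such that for all m ∈ J_κ: ρ(γ_i^{±1}) r_m = q^{±(m_i − κ)} r_m for 1 ≤ i ≤ n (and ρ(γ_{2n+1−i}) = ρ(γ_i)); ρ(β_j) r_m = q^{−m_{j+1}+κ} [m_j]_q r_{m − e_j + e_{j+1}} and ρ(β_{2n−j}) r_m = q^{−m_j+κ} [m_{j+1}]_q r_{m + e_j − e_{j+1}} for 1 ≤ j ≤ n−1; and ρ(β_n) r_m = ((q^{−σ+2(κ−κ_1−m_n)} − q^{σ+2κ_1})/(q − q^{-1})) r_m. -/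
namespace QG

/-- Generators of the quantized universal enveloping algebra `U_q(gl(m))`:
`K i`, its inverse `Ki i`, and the Chevalley generators `E j` (the `x_j`)
and `F j` (the `y_j`).  Indices are 1-based natural numbers; out-of-range
generators are forced to be `1` (resp. `0`) by the relations. -/
inductive Gen : Type where
  | K : ℕ → Gen
  | Ki : ℕ → Gen
  | E : ℕ → Gen
  | F : ℕ → Gen

abbrev FA := FreeAlgebra ℂ Gen

noncomputable def fK (i : ℕ) : FA := FreeAlgebra.ι ℂ (Gen.K i)
noncomputable def fKi (i : ℕ) : FA := FreeAlgebra.ι ℂ (Gen.Ki i)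
noncomputable def fE (i : ℕ) : FA := FreeAlgebra.ι ℂ (Gen.E i)
noncomputable def fF (i : ℕ) : FA := FreeAlgebra.ι ℂ (Gen.F i)

/-- Kronecker delta with values in `ℤ`. -/
def kd (i j : ℕ) : ℤ := if i = j then 1 else 0

/-- The defining relations of `U_q(gl(m))`. -/
inductive Rel (q : ℝ) (m : ℕ) : FA → FA → Prop
  | Kout : ∀ i, ¬(1 ≤ i ∧ i ≤ m) → Rel q m (fK i) 1
  | Kiout : ∀ i, ¬(1 ≤ i ∧ i ≤ m) → Rel q m (fKi i) 1
  | Eout : ∀ j, ¬(1 ≤ j ∧ j + 1 ≤ m) → Rel q m (fE j) 0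
  | Fout : ∀ j, ¬(1 ≤ j ∧ j + 1 ≤ m) → Rel q m (fF j) 0
  | KK : ∀ i j, Rel q m (fK i * fK j) (fK j * fK i)
  | KKi : ∀ i, Rel q m (fK i * fKi i) 1
  | KiK : ∀ i, Rel q m (fKi i * fK i) 1
  | KE : ∀ i j, 1 ≤ i → i ≤ m → 1 ≤ j → j + 1 ≤ m →
      Rel q m (fK i * fE j) (((q : ℂ) ^ (kd i j - kd i (j+1))) • (fE j * fK i))
  | KF : ∀ i j, 1 ≤ i → i ≤ m → 1 ≤ j → j + 1 ≤ m →
      Rel q m (fK i * fF j) (((q : ℂ) ^ (kd i (j+1) - kd i j)) • (fF j * fK i))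
  | EF : ∀ i j, 1 ≤ i → i + 1 ≤ m → 1 ≤ j → j + 1 ≤ m →
      Rel q m (fE i * fF j - fF j * fE i)
        (if i = j then ((q : ℂ) - (q : ℂ)⁻¹)⁻¹ • (fK i * fKi (i+1) - fKi i * fK (i+1)) else 0)
  | EE : ∀ i j, 1 ≤ i → i + 1 ≤ m → 1 ≤ j → j + 1 ≤ m → (i + 2 ≤ j ∨ j + 2 ≤ i) →
      Rel q m (fE i * fE j) (fE j * fE i)
  | FF : ∀ i j, 1 ≤ i → i + 1 ≤ m → 1 ≤ j → j + 1 ≤ m → (i + 2 ≤ j ∨ j + 2 ≤ i) →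
      Rel q m (fF i * fF j) (fF j * fF i)
  | Eserre : ∀ i j, 1 ≤ i → i + 1 ≤ m → 1 ≤ j → j + 1 ≤ m → (i + 1 = j ∨ j + 1 = i) →
      Rel q m (fE i ^ 2 * fE j - ((q : ℂ) + (q : ℂ)⁻¹) • (fE i * fE j * fE i) + fE j * fE i ^ 2) 0
  | Fserre : ∀ i j, 1 ≤ i → i + 1 ≤ m → 1 ≤ j → j + 1 ≤ m → (i + 1 = j ∨ j + 1 = i) →
      Rel q m (fF i ^ 2 * fF j - ((q : ℂ) + (q : ℂ)⁻¹) • (fF i * fF j * fF i) + fF j * fF i ^ 2) 0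

/-- The quantized universal enveloping algebra `U_q(gl(m))`. -/
abbrev Uq (q : ℝ) (m : ℕ) := RingQuot (Rel q m)

noncomputable def uK (q : ℝ) (m i : ℕ) : Uq q m := RingQuot.mkAlgHom ℂ (Rel q m) (fK i)
noncomputable def uKi (q : ℝ) (m i : ℕ) : Uq q m := RingQuot.mkAlgHom ℂ (Rel q m) (fKi i)
noncomputable def uE (q : ℝ) (m i : ℕ) : Uq q m := RingQuot.mkAlgHom ℂ (Rel q m) (fE i)
noncomputable def uF (q : ℝ) (m i : ℕ) : Uq q m := RingQuot.mkAlgHom ℂ (Rel q m) (fF i)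

/-- `C_i = K_i K_{2n+1-i}` in `U_q(gl(2n))`. -/
noncomputable def Cc (q : ℝ) (n i : ℕ) : Uq q (2*n) := uK q (2*n) i * uK q (2*n) (2*n+1-i)
/-- `C_i⁻¹ = K_i⁻¹ K_{2n+1-i}⁻¹` in `U_q(gl(2n))`. -/
noncomputable def Ccinv (q : ℝ) (n i : ℕ) : Uq q (2*n) := uKi q (2*n) i * uKi q (2*n) (2*n+1-i)
/-- `B_j = y_j K_{j+1}⁻¹ K_{2n-j}⁻¹ + K_j⁻¹ x_{2n-j} K_{2n-j}⁻¹` in `U_q(gl(2n))`. -/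
noncomputable def Bb (q : ℝ) (n j : ℕ) : Uq q (2*n) :=
  uF q (2*n) j * uKi q (2*n) (j+1) * uKi q (2*n) (2*n-j)
  + uKi q (2*n) j * uE q (2*n) (2*n-j) * uKi q (2*n) (2*n-j)
/-- `B_n^σ = y_n K_{n+1}⁻¹ K_n⁻¹ + K_n⁻¹ x_n K_n⁻¹ + ((q^{-σ}-q^{σ})/(q-q⁻¹)) K_n⁻²`. -/
noncomputable def Bs (q σ : ℝ) (n : ℕ) : Uq q (2*n) :=
  uF q (2*n) n * uKi q (2*n) (n+1) * uKi q (2*n) n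
  + uKi q (2*n) n * uE q (2*n) n * uKi q (2*n) n
  + (((q ^ (-σ) - q ^ σ) / (q - q⁻¹) : ℝ) : ℂ) • ((uKi q (2*n) n)^2)

/-- The generating set of the coideal subalgebra `𝒜_σ ⊆ U_q(gl(2n))`. -/
def ASet (q σ : ℝ) (n : ℕ) : Set (Uq q (2*n)) :=
  {z | (∃ i, 1 ≤ i ∧ i ≤ 2*n ∧ (z = Cc q n i ∨ z = Ccinv q n i)) ∨
       (∃ j, 1 ≤ j ∧ j + 1 ≤ 2*n ∧ j ≠ n ∧ z = Bb q n j) ∨ z = Bs q σ n}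

/-- Generators of the abstract algebra `𝒜`. -/
inductive AGen : Type where
  | g : ℕ → AGen
  | gi : ℕ → AGen
  | b : ℕ → AGen

abbrev AFA := FreeAlgebra ℂ AGen

noncomputable def fγ (i : ℕ) : AFA := FreeAlgebra.ι ℂ (AGen.g i)
noncomputable def fγi (i : ℕ) : AFA := FreeAlgebra.ι ℂ (AGen.gi i)
noncomputable def fβ (j : ℕ) : AFA := FreeAlgebra.ι ℂ (AGen.b j)

/-- `(ε_i + ε_{2n+1-i}, α_j)` where `α_j = ε_j - ε_{j+1}`. -/
def gex (n i j : ℕ) : ℤ := kd i j + kd (2*n+1-i) j - kd i (j+1) - kd (2*n+1-i) (j+1)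

/-- The defining relations of the algebra `𝒜`. -/
inductive ARel (q : ℝ) (n : ℕ) : AFA → AFA → Prop
  | gout : ∀ i, ¬(1 ≤ i ∧ i ≤ 2*n) → ARel q n (fγ i) 1
  | giout : ∀ i, ¬(1 ≤ i ∧ i ≤ 2*n) → ARel q n (fγi i) 1
  | bout : ∀ j, ¬(1 ≤ j ∧ j + 1 ≤ 2*n) → ARel q n (fβ j) 0
  | gg : ∀ i j, ARel q n (fγ i * fγ j) (fγ j * fγ i)
  | ggi : ∀ i, ARel q n (fγ i * fγi i) 1
  | gig : ∀ i, ARel q n (fγi i * fγ i) 1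
  | gsym : ∀ i, 1 ≤ i → i ≤ 2*n → ARel q n (fγ i) (fγ (2*n+1-i))
  | gb : ∀ i j, 1 ≤ i → i ≤ 2*n → 1 ≤ j → j + 1 ≤ 2*n →
      ARel q n (fγ i * fβ j) (((q : ℂ) ^ (-(gex n i j))) • (fβ j * fγ i))
  | bb : ∀ i j, 1 ≤ i → i + 1 ≤ 2*n → 1 ≤ j → j + 1 ≤ 2*n → (i + 2 ≤ j ∨ j + 2 ≤ i) →
      ARel q n (fβ i * fβ j - fβ j * fβ i)
        (if i + j = 2*n then ((q : ℂ) * ((q : ℂ) - (q : ℂ)⁻¹)⁻¹) • (fγi i ^ 2 - fγi (i+1) ^ 2)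
         else 0)
  | serre1 : ∀ i, 1 ≤ i → i + 2 ≤ 2*n →
      ARel q n
        ((q : ℂ)⁻¹ • (fβ i ^ 2 * fβ (i+1)) - ((q : ℂ) + (q : ℂ)⁻¹) • (fβ i * fβ (i+1) * fβ i)
          + (q : ℂ) • (fβ (i+1) * fβ i ^ 2))
        (if i = n then (q : ℂ) • (fβ (n+1) * fγi n ^ 2) else 0)
  | serre2 : ∀ i, 2 ≤ i → i + 1 ≤ 2*n →
      ARel q n
        ((q : ℂ) • (fβ i ^ 2 * fβ (i-1)) - ((q : ℂ) + (q : ℂ)⁻¹) • (fβ i * fβ (i-1) * fβ i)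
          + (q : ℂ)⁻¹ • (fβ (i-1) * fβ i ^ 2))
        (if i = n then (q : ℂ)⁻¹ • (fβ (n-1) * fγi n ^ 2) else 0)

/-- The abstract algebra `𝒜`. -/
abbrev Aalg (q : ℝ) (n : ℕ) := RingQuot (ARel q n)

noncomputable def aγ (q : ℝ) (n i : ℕ) : Aalg q n := RingQuot.mkAlgHom ℂ (ARel q n) (fγ i)
noncomputable def aγi (q : ℝ) (n i : ℕ) : Aalg q n := RingQuot.mkAlgHom ℂ (ARel q n) (fγi i)
noncomputable def aβ (q : ℝ) (n j : ℕ) : Aalg q n := RingQuot.mkAlgHom ℂ (ARel q n) (fβ j)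

end QG

namespace QG

/-- The condition `m ∈ J_κ` (supported on `{1,…,n}`, nonnegative, summing to `nκ`). -/
def mOK (n κ : ℕ) (m : ℕ → ℤ) : Prop :=
  (∀ i, (i = 0 ∨ n < i) → m i = 0) ∧ (∀ i, 0 ≤ m i) ∧
    (∑ i ∈ Finset.Icc 1 n, m i) = (n : ℤ) * κ

/-- The vector space `V(κ,κ₁)` with basis `{r_m : m ∈ J_κ}`. -/
abbrev Vk (n κ : ℕ) := {m : ℕ → ℤ // mOK n κ m} →₀ ℂ

open Classical in
/-- The basis vector `r_m`, with the convention `r_m = 0` for `m ∉ J_κ`. -/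
noncomputable def rv (n κ : ℕ) (m : ℕ → ℤ) : Vk n κ :=
  if h : mOK n κ m then Finsupp.single ⟨m, h⟩ 1 else 0

/-- The standard basis vector `e_j` of `ℤ^n` (1-based). -/
def ev (j : ℕ) : ℕ → ℤ := fun t => if t = j then 1 else 0

/-- The symmetric `q`-number `[a]_q = (q^a − q^{−a})/(q − q⁻¹)`. -/
noncomputable def qnum (q : ℝ) (a : ℤ) : ℂ :=
  ((q : ℂ) ^ a - (q : ℂ) ^ (-a)) / ((q : ℂ) - (q : ℂ)⁻¹)

/-- The defining properties of the representation `ρ(κ,κ₁)_σ` of `𝒜` on `V(κ,κ₁)`. -/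
def repOK (q σ : ℝ) (n κ : ℕ) (κ₁ : ℤ)
    (ρ : Aalg q n →ₐ[ℂ] Module.End ℂ (Vk n κ)) : Prop :=
  ∀ m : ℕ → ℤ, mOK n κ m →
    (∀ i, 1 ≤ i → i ≤ n →
      ρ (aγ q n i) (rv n κ m) = ((q : ℂ) ^ (m i - (κ : ℤ))) • rv n κ m ∧
      ρ (aγi q n i) (rv n κ m) = ((q : ℂ) ^ (-(m i - (κ : ℤ)))) • rv n κ m ∧
      ρ (aγ q n (2*n+1-i)) = ρ (aγ q n i)) ∧
    (∀ j, 1 ≤ j → j + 1 ≤ n →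
      ρ (aβ q n j) (rv n κ m)
        = ((q : ℂ) ^ ((κ : ℤ) - m (j+1)) * qnum q (m j)) •
            rv n κ (fun t => m t - ev j t + ev (j+1) t) ∧
      ρ (aβ q n (2*n-j)) (rv n κ m)
        = ((q : ℂ) ^ ((κ : ℤ) - m j) * qnum q (m (j+1))) •
            rv n κ (fun t => m t + ev j t - ev (j+1) t)) ∧
    ρ (aβ q n n) (rv n κ m)
      = (((q ^ (-σ + 2*((κ : ℝ) - (κ₁ : ℝ) - ((m n : ℤ) : ℝ)))
            - q ^ (σ + 2*(κ₁ : ℝ))) / (q - q⁻¹) : ℝ) : ℂ) • rv n κ m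

end QG

namespace QG

/-- The free vector space on the lattice `ℤ^ℕ`, containing `V(κ,κ₁)` as a subspace. -/
abbrev LatticeSpace := (ℕ → ℤ) →₀ ℂ

/-- The weighted shift `r_m ↦ c(m) r_{m+v}` on the lattice. -/
noncomputable def wShift (c : (ℕ → ℤ) → ℂ) (v : ℕ → ℤ) : Module.End ℂ LatticeSpace :=
  Finsupp.lsum ℂ fun m => c m • Finsupp.lsingle (m + v)

@[simp]
lemma wShift_single (c : (ℕ → ℤ) → ℂ) (v m : ℕ → ℤ) (x : ℂ) :
    wShift c v (Finsupp.single m x) = Finsupp.single (m + v) (c m * x) := by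
  simp [wShift]

lemma latticeSpace_end_ext {S T : Module.End ℂ LatticeSpace}
    (h : ∀ m, S (Finsupp.single m 1) = T (Finsupp.single m 1)) : S = T :=
  Finsupp.lhom_ext' fun m => LinearMap.ext_ring (h m)

lemma wShift_congr {c d : (ℕ → ℤ) → ℂ} {v w : ℕ → ℤ} (hc : ∀ m, c m = d m) (hv : v = w) :
    wShift c v = wShift d w := by
  rw [funext hc, hv]

lemma wShift_mul (c d : (ℕ → ℤ) → ℂ) (v w : ℕ → ℤ) :
    wShift c v * wShift d w = wShift (fun m => c (m + w) * d m) (w + v) :=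
  latticeSpace_end_ext fun m => by simp [Module.End.mul_apply, add_assoc]

lemma smul_wShift (k : ℂ) (c : (ℕ → ℤ) → ℂ) (v : ℕ → ℤ) :
    k • wShift c v = wShift (fun m => k * c m) v :=
  latticeSpace_end_ext fun m => by simp

lemma wShift_sub (c d : (ℕ → ℤ) → ℂ) (v : ℕ → ℤ) :
    wShift c v - wShift d v = wShift (fun m => c m - d m) v :=
  latticeSpace_end_ext fun m => by simp [Finsupp.single_sub]

lemma wShift_add (c d : (ℕ → ℤ) → ℂ) (v : ℕ → ℤ) :
    wShift c v + wShift d v = wShift (fun m => c m + d m) v :=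
  latticeSpace_end_ext fun m => by simp [Finsupp.single_add]

lemma wShift_eq_one {c : (ℕ → ℤ) → ℂ} {v : ℕ → ℤ} (hc : ∀ m, c m = 1) (hv : v = 0) :
    wShift c v = 1 :=
  latticeSpace_end_ext fun m => by simp [hc, hv]

lemma wShift_eq_zero {c : (ℕ → ℤ) → ℂ} {v : ℕ → ℤ} (hc : ∀ m, c m = 0) : wShift c v = 0 :=
  latticeSpace_end_ext fun m => by simp [hc]

lemma wShift_commutator {c d e : (ℕ → ℤ) → ℂ} {v w : ℕ → ℤ}
    (h : ∀ m, c (m + w) * d m - d (m + v) * c m = e m) :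
    wShift c v * wShift d w - wShift d w * wShift c v = wShift e (v + w) := by
  rw [wShift_mul, wShift_mul, add_comm w v, wShift_sub]
  exact wShift_congr h rfl

lemma wShift_serre {c d e : (ℕ → ℤ) → ℂ} {v w : ℕ → ℤ} {x y z : ℂ}
    (h : ∀ m, x * (c (m + w + v) * c (m + w) * d m) - y * (c (m + v + w) * d (m + v) * c m)
      + z * (d (m + v + v) * c (m + v) * c m) = e m) :
    x • (wShift c v ^ 2 * wShift d w) - y • (wShift c v * wShift d w * wShift c v)
      + z • (wShift d w * wShift c v ^ 2) = wShift e (v + v + w) := by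
  simp only [pow_two, wShift_mul, smul_wShift]
  rw [show w + (v + v) = v + v + w by abel, show v + (w + v) = v + v + w by abel,
    wShift_sub, wShift_add]
  refine wShift_congr (fun m => ?_) rfl
  rw [← h m]
  simp only [add_assoc]
  ring

/-- `r_m ↦ q^{m_a-κ} r_m`. -/
noncomputable def cartanOp (q : ℝ) (κ a : ℕ) : Module.End ℂ LatticeSpace :=
  wShift (fun m => (q : ℂ) ^ (m a - (κ : ℤ))) 0

/-- `r_m ↦ q^{-(m_a-κ)} r_m`. -/
noncomputable def cartanInvOp (q : ℝ) (κ a : ℕ) : Module.End ℂ LatticeSpace :=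
  wShift (fun m => (q : ℂ) ^ (-(m a - (κ : ℤ)))) 0

/-- `r_m ↦ q^{κ-m_b} [m_a]_q r_{m-e_a+e_b}`. -/
noncomputable def moveOp (q : ℝ) (κ a b : ℕ) : Module.End ℂ LatticeSpace :=
  wShift (fun m => (q : ℂ) ^ ((κ : ℤ) - m b) * qnum q (m a)) (ev b - ev a)

/-- The diagonal operator with eigenvalue `(A q^{-2m_a} - B)/(q-q⁻¹)` on `r_m`. -/
noncomputable def diagOp (q : ℝ) (A B : ℂ) (a : ℕ) : Module.End ℂ LatticeSpace :=
  wShift (fun m => (A * (q : ℂ) ^ (-(2 * m a)) - B) / ((q : ℂ) - (q : ℂ)⁻¹)) 0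


@[simp] lemma ev_self (a : ℕ) : ev a a = 1 := by simp [ev]

lemma ev_of_ne {a b : ℕ} (h : b ≠ a) : ev a b = 0 := by simp [ev, h]

lemma sub_inv_ne_zero_of_mem_Ioo {q : ℝ} (hq0 : 0 < q) (hq1 : q < 1) :
    (q : ℂ) - (q : ℂ)⁻¹ ≠ 0 := by
  have h : q - q⁻¹ ≠ 0 := by
    have := (one_lt_inv₀ hq0).2 hq1
    linarith
  exact_mod_cast h

lemma cartanOp_mul_cartanInvOp {q : ℝ} (hq : (q : ℂ) ≠ 0) (κ a : ℕ) :
    cartanOp q κ a * cartanInvOp q κ a = 1 := by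
  rw [cartanOp, cartanInvOp, wShift_mul]
  refine wShift_eq_one (fun m => ?_) (by simp)
  simp only [add_zero]
  rw [← zpow_add₀ hq, add_neg_cancel, zpow_zero]

lemma cartanInvOp_mul_cartanOp {q : ℝ} (hq : (q : ℂ) ≠ 0) (κ a : ℕ) :
    cartanInvOp q κ a * cartanOp q κ a = 1 := by
  rw [cartanOp, cartanInvOp, wShift_mul]
  refine wShift_eq_one (fun m => ?_) (by simp)
  simp only [add_zero]
  rw [← zpow_add₀ hq, neg_add_cancel, zpow_zero]

lemma cartanOp_comm (q : ℝ) (κ a b : ℕ) :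
    cartanOp q κ a * cartanOp q κ b = cartanOp q κ b * cartanOp q κ a := by
  simp only [cartanOp, wShift_mul]
  exact wShift_congr (fun m => by simp [mul_comm]) rfl

lemma cartanOp_mul_wShift {q : ℝ} (hq : (q : ℂ) ≠ 0) (κ a : ℕ) (c : (ℕ → ℤ) → ℂ)
    (v : ℕ → ℤ) :
    cartanOp q κ a * wShift c v = (q : ℂ) ^ v a • (wShift c v * cartanOp q κ a) := by
  simp only [cartanOp, wShift_mul, smul_wShift]
  refine wShift_congr (fun m => ?_) (by simp)
  rw [Pi.add_apply, show m a + v a - (κ : ℤ) = v a + (m a - κ) by ring, zpow_add₀ hq]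
  simp
  ring

lemma moveOp_comm_of_disjoint (q : ℝ) (κ : ℕ) {a b c d : ℕ} (hac : a ≠ c) (had : a ≠ d)
    (hbc : b ≠ c) (hbd : b ≠ d) :
    moveOp q κ a b * moveOp q κ c d - moveOp q κ c d * moveOp q κ a b = 0 := by
  rw [moveOp, moveOp, wShift_commutator fun m => rfl]
  refine wShift_eq_zero fun m => ?_
  simp [ev_of_ne, hac, had, hbc, hbd, hac.symm, had.symm, hbc.symm, hbd.symm]
  ring

lemma moveOp_comm_of_same_source (q : ℝ) (κ : ℕ) {a b c : ℕ} (hab : a ≠ b)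
    (hac : a ≠ c) (hbc : b ≠ c) :
    moveOp q κ a b * moveOp q κ a c - moveOp q κ a c * moveOp q κ a b = 0 := by
  rw [moveOp, moveOp, wShift_commutator fun m => rfl]
  refine wShift_eq_zero fun m => ?_
  simp [ev_of_ne, hab, hac, hbc, hab.symm, hac.symm, hbc.symm]
  ring

lemma moveOp_comm_of_same_target (q : ℝ) (κ : ℕ) {a b c : ℕ} (hab : a ≠ b)
    (hac : a ≠ c) (hbc : b ≠ c) :
    moveOp q κ a b * moveOp q κ c b - moveOp q κ c b * moveOp q κ a b = 0 := by
  rw [moveOp, moveOp, wShift_commutator fun m => rfl]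
  refine wShift_eq_zero fun m => ?_
  simp [ev_of_ne, hab, hac, hbc, hab.symm, hac.symm, hbc.symm]
  ring

lemma moveOp_commutator_swap {q : ℝ} (hq : (q : ℂ) ≠ 0) (hd : (q : ℂ) - (q : ℂ)⁻¹ ≠ 0) (κ : ℕ)
    {a b : ℕ} (hab : a ≠ b) :
    moveOp q κ a b * moveOp q κ b a - moveOp q κ b a * moveOp q κ a b
      = ((q : ℂ) * ((q : ℂ) - (q : ℂ)⁻¹)⁻¹) • (cartanInvOp q κ a ^ 2 - cartanInvOp q κ b ^ 2) := by
  rw [moveOp, moveOp, wShift_commutator fun m => rfl]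
  simp only [cartanInvOp, pow_two, wShift_mul, wShift_sub, smul_wShift]
  refine wShift_congr (fun m => ?_) (by simp)
  simp only [Pi.add_apply, Pi.sub_apply, ev_self, ev_of_ne hab, ev_of_ne hab.symm, qnum,
    Pi.zero_apply]
  generalize (q : ℂ) = Q at *
  have hd' : Q ^ 2 - 1 ≠ 0 := fun h => hd (by field_simp; linear_combination h)
  simp only [zpow_add₀ hq, zpow_sub₀ hq, zpow_neg, zpow_one, zpow_zero, neg_sub]
  have hX := zpow_ne_zero (m a) hq
  have hY := zpow_ne_zero (m b) hq
  have hK := zpow_ne_zero (κ : ℤ) hq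
  generalize Q ^ m a = X at *
  generalize Q ^ m b = Y at *
  generalize Q ^ (κ : ℤ) = K at *
  field_simp
  ring

lemma moveOp_serre_next {q : ℝ} (hq : (q : ℂ) ≠ 0) (κ : ℕ)
    {a b c : ℕ} (hab : a ≠ b) (hac : a ≠ c) (hbc : b ≠ c) :
    (q : ℂ)⁻¹ • (moveOp q κ a b ^ 2 * moveOp q κ b c)
      - ((q : ℂ) + (q : ℂ)⁻¹) • (moveOp q κ a b * moveOp q κ b c * moveOp q κ a b)
      + (q : ℂ) • (moveOp q κ b c * moveOp q κ a b ^ 2) = 0 := by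
  rw [moveOp, moveOp, wShift_serre fun m => rfl]
  refine wShift_eq_zero fun m => ?_
  simp only [Pi.add_apply, Pi.sub_apply, ev_self, ev_of_ne hab, ev_of_ne hab.symm, ev_of_ne hac,
    ev_of_ne hac.symm, ev_of_ne hbc, ev_of_ne hbc.symm, qnum]
  generalize (q : ℂ) = Q at *
  simp only [div_eq_mul_inv]
  generalize (Q - Q⁻¹)⁻¹ = d
  simp only [zpow_add₀ hq, zpow_sub₀ hq, zpow_neg, zpow_one, zpow_zero]
  have hX := zpow_ne_zero (m a) hq
  have hY := zpow_ne_zero (m b) hq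
  have hZ := zpow_ne_zero (m c) hq
  have hK := zpow_ne_zero (κ : ℤ) hq
  generalize Q ^ m a = X at *
  generalize Q ^ m b = Y at *
  generalize Q ^ m c = Z at *
  generalize Q ^ (κ : ℤ) = K at *
  field_simp
  ring

lemma moveOp_serre_prev {q : ℝ} (hq : (q : ℂ) ≠ 0) (κ : ℕ)
    {a b c : ℕ} (hab : a ≠ b) (hac : a ≠ c) (hbc : b ≠ c) :
    (q : ℂ) • (moveOp q κ b c ^ 2 * moveOp q κ a b)
      - ((q : ℂ) + (q : ℂ)⁻¹) • (moveOp q κ b c * moveOp q κ a b * moveOp q κ b c)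
      + (q : ℂ)⁻¹ • (moveOp q κ a b * moveOp q κ b c ^ 2) = 0 := by
  rw [moveOp, moveOp, wShift_serre fun m => rfl]
  refine wShift_eq_zero fun m => ?_
  simp only [Pi.add_apply, Pi.sub_apply, ev_self, ev_of_ne hab, ev_of_ne hab.symm, ev_of_ne hac,
    ev_of_ne hac.symm, ev_of_ne hbc, ev_of_ne hbc.symm, qnum]
  generalize (q : ℂ) = Q at *
  simp only [div_eq_mul_inv]
  generalize (Q - Q⁻¹)⁻¹ = d
  simp only [zpow_add₀ hq, zpow_sub₀ hq, zpow_neg, zpow_one, zpow_zero]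
  have hX := zpow_ne_zero (m a) hq
  have hY := zpow_ne_zero (m b) hq
  have hZ := zpow_ne_zero (m c) hq
  have hK := zpow_ne_zero (κ : ℤ) hq
  generalize Q ^ m a = X at *
  generalize Q ^ m b = Y at *
  generalize Q ^ m c = Z at *
  generalize Q ^ (κ : ℤ) = K at *
  field_simp
  ring

lemma diagOp_comm_moveOp (q : ℝ) (A B : ℂ) (κ : ℕ) {a b c : ℕ} (hab : a ≠ b) (hac : a ≠ c) :
    diagOp q A B a * moveOp q κ b c - moveOp q κ b c * diagOp q A B a = 0 := by
  rw [moveOp, diagOp, wShift_commutator fun m => rfl]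
  refine wShift_eq_zero fun m => ?_
  simp [ev_of_ne hab, ev_of_ne hac]
  ring

lemma moveOp_diagOp_serre {q : ℝ} (hq : (q : ℂ) ≠ 0) (A B : ℂ) (κ : ℕ) {a b : ℕ} (hab : a ≠ b) :
    (q : ℂ)⁻¹ • (moveOp q κ a b ^ 2 * diagOp q A B b)
      - ((q : ℂ) + (q : ℂ)⁻¹) • (moveOp q κ a b * diagOp q A B b * moveOp q κ a b)
      + (q : ℂ) • (diagOp q A B b * moveOp q κ a b ^ 2) = 0 := by
  rw [moveOp, diagOp, wShift_serre fun m => rfl]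
  refine wShift_eq_zero fun m => ?_
  simp only [Pi.add_apply, Pi.sub_apply, Pi.zero_apply, ev_self, ev_of_ne hab, ev_of_ne hab.symm,
    qnum]
  generalize (q : ℂ) = Q at *
  simp only [div_eq_mul_inv]
  generalize (Q - Q⁻¹)⁻¹ = d
  simp only [mul_add, mul_sub, mul_one, mul_zero, two_mul, neg_add, neg_sub, neg_zero,
    zpow_add₀ hq, zpow_sub₀ hq, zpow_neg, zpow_one, zpow_zero]
  have hX := zpow_ne_zero (m a) hq
  have hY := zpow_ne_zero (m b) hq
  have hK := zpow_ne_zero (κ : ℤ) hq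
  generalize Q ^ m a = X at *
  generalize Q ^ m b = Y at *
  generalize Q ^ (κ : ℤ) = K at *
  field_simp
  ring

lemma moveOp_diagOp_serre' {q : ℝ} (hq : (q : ℂ) ≠ 0) (A B : ℂ) (κ : ℕ) {a b : ℕ} (hab : a ≠ b) :
    (q : ℂ) • (moveOp q κ a b ^ 2 * diagOp q A B a)
      - ((q : ℂ) + (q : ℂ)⁻¹) • (moveOp q κ a b * diagOp q A B a * moveOp q κ a b)
      + (q : ℂ)⁻¹ • (diagOp q A B a * moveOp q κ a b ^ 2) = 0 := by
  rw [moveOp, diagOp, wShift_serre fun m => rfl]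
  refine wShift_eq_zero fun m => ?_
  simp only [Pi.add_apply, Pi.sub_apply, Pi.zero_apply, ev_self, ev_of_ne hab, ev_of_ne hab.symm,
    qnum]
  generalize (q : ℂ) = Q at *
  simp only [div_eq_mul_inv]
  generalize (Q - Q⁻¹)⁻¹ = d
  simp only [mul_add, mul_sub, mul_one, mul_zero, two_mul, neg_add, neg_sub, neg_zero,
    zpow_add₀ hq, zpow_sub₀ hq, zpow_neg, zpow_one, zpow_zero]
  have hX := zpow_ne_zero (m a) hq
  have hY := zpow_ne_zero (m b) hq
  have hK := zpow_ne_zero (κ : ℤ) hq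
  generalize Q ^ m a = X at *
  generalize Q ^ m b = Y at *
  generalize Q ^ (κ : ℤ) = K at *
  field_simp
  ring

lemma diagOp_serre_next {q : ℝ} (hq : (q : ℂ) ≠ 0) (hd : (q : ℂ) - (q : ℂ)⁻¹ ≠ 0) {A B : ℂ}
    {κ : ℕ} (hAB : A * B = (q : ℂ) ^ (2 * (κ : ℤ))) {a b : ℕ} (hab : a ≠ b) :
    (q : ℂ)⁻¹ • (diagOp q A B a ^ 2 * moveOp q κ a b)
      - ((q : ℂ) + (q : ℂ)⁻¹) • (diagOp q A B a * moveOp q κ a b * diagOp q A B a)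
      + (q : ℂ) • (moveOp q κ a b * diagOp q A B a ^ 2)
      = (q : ℂ) • (moveOp q κ a b * cartanInvOp q κ a ^ 2) := by
  rw [moveOp, diagOp, wShift_serre fun m => rfl]
  simp only [cartanInvOp, pow_two, wShift_mul, smul_wShift]
  refine wShift_congr (fun m => ?_) (by simp)
  simp only [Pi.add_apply, Pi.sub_apply, Pi.zero_apply, ev_self, ev_of_ne hab,
    add_zero]
  generalize (q : ℂ) = Q at *
  generalize qnum q (m a) = N
  have hd' : Q ^ 2 - 1 ≠ 0 := fun h => hd (by field_simp; linear_combination h)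
  simp only [mul_add, mul_sub, mul_one, mul_zero, two_mul, neg_add, neg_sub,
    zpow_add₀ hq, zpow_sub₀ hq, zpow_neg, zpow_zero] at hAB ⊢
  have hX := zpow_ne_zero (m a) hq
  have hY := zpow_ne_zero (m b) hq
  have hK := zpow_ne_zero (κ : ℤ) hq
  generalize Q ^ m a = X at *
  generalize Q ^ m b = Y at *
  generalize Q ^ (κ : ℤ) = K at *
  field_simp
  linear_combination N * X ^ 2 * (Q ^ 2 - 1) ^ 2 * hAB

lemma diagOp_serre_prev {q : ℝ} (hq : (q : ℂ) ≠ 0) (hd : (q : ℂ) - (q : ℂ)⁻¹ ≠ 0) {A B : ℂ}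
    {κ : ℕ} (hAB : A * B = (q : ℂ) ^ (2 * (κ : ℤ))) {a b : ℕ} (hab : a ≠ b) :
    (q : ℂ) • (diagOp q A B b ^ 2 * moveOp q κ a b)
      - ((q : ℂ) + (q : ℂ)⁻¹) • (diagOp q A B b * moveOp q κ a b * diagOp q A B b)
      + (q : ℂ)⁻¹ • (moveOp q κ a b * diagOp q A B b ^ 2)
      = (q : ℂ)⁻¹ • (moveOp q κ a b * cartanInvOp q κ b ^ 2) := by
  rw [moveOp, diagOp, wShift_serre fun m => rfl]
  simp only [cartanInvOp, pow_two, wShift_mul, smul_wShift]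
  refine wShift_congr (fun m => ?_) (by simp)
  simp only [Pi.add_apply, Pi.sub_apply, Pi.zero_apply, ev_self, ev_of_ne hab.symm,
    add_zero]
  generalize (q : ℂ) = Q at *
  generalize qnum q (m a) = N
  have hd' : Q ^ 2 - 1 ≠ 0 := fun h => hd (by field_simp; linear_combination h)
  simp only [mul_add, mul_sub, mul_one, mul_zero, two_mul, neg_add, neg_sub,
    zpow_add₀ hq, zpow_sub₀ hq, zpow_neg, zpow_zero] at hAB ⊢
  have hX := zpow_ne_zero (m a) hq
  have hY := zpow_ne_zero (m b) hq
  have hK := zpow_ne_zero (κ : ℤ) hq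
  generalize Q ^ m a = X at *
  generalize Q ^ m b = Y at *
  generalize Q ^ (κ : ℤ) = K at *
  field_simp
  linear_combination N * Y ^ 2 * (Q ^ 2 - 1) ^ 2 * hAB

/-- The folding `i ↦ i`, `2n+1-i ↦ i` (`1 ≤ i ≤ n`) of `{1,…,2n}` onto `{1,…,n}`. -/
def foldIdx (n i : ℕ) : ℕ := if i ≤ n then i else 2 * n + 1 - i

lemma foldIdx_of_le {n i : ℕ} (h : i ≤ n) : foldIdx n i = i := if_pos h

lemma foldIdx_of_lt {n i : ℕ} (h : n < i) : foldIdx n i = 2 * n + 1 - i := if_neg (by omega)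

lemma foldIdx_eq_iff {n i j : ℕ} (hi : 1 ≤ i) (hi' : i ≤ 2 * n) (hj : 1 ≤ j) (hj' : j ≤ 2 * n) :
    foldIdx n i = foldIdx n j ↔ i = j ∨ i + j = 2 * n + 1 := by
  unfold foldIdx
  split_ifs <;> omega

/-- The action of the generators of `𝒜` on the lattice space. -/
noncomputable def latticeGen (q : ℝ) (n κ : ℕ) (A B : ℂ) : AGen → Module.End ℂ LatticeSpace
  | .g i => if 1 ≤ i ∧ i ≤ 2 * n then cartanOp q κ (foldIdx n i) else 1
  | .gi i => if 1 ≤ i ∧ i ≤ 2 * n then cartanInvOp q κ (foldIdx n i) else 1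
  | .b j => if 1 ≤ j ∧ j + 1 ≤ 2 * n then
      if j = n then diagOp q A B n else moveOp q κ (foldIdx n j) (foldIdx n (j + 1)) else 0

/-- The free algebra acting on the lattice space. -/
noncomputable def latticeRep (q : ℝ) (n κ : ℕ) (A B : ℂ) :
    AFA →ₐ[ℂ] Module.End ℂ LatticeSpace :=
  FreeAlgebra.lift ℂ (latticeGen q n κ A B)

section latticeRep

variable (q : ℝ) (n κ : ℕ) (A B : ℂ)

lemma latticeRep_γ {i : ℕ} (hi : 1 ≤ i ∧ i ≤ 2 * n) :
    latticeRep q n κ A B (fγ i) = cartanOp q κ (foldIdx n i) := by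
  simp [latticeRep, fγ, latticeGen, hi]

lemma latticeRep_γ_of_not {i : ℕ} (hi : ¬(1 ≤ i ∧ i ≤ 2 * n)) :
    latticeRep q n κ A B (fγ i) = 1 := by
  rw [latticeRep, fγ, FreeAlgebra.lift_ι_apply, latticeGen, if_neg hi]

lemma latticeRep_γi {i : ℕ} (hi : 1 ≤ i ∧ i ≤ 2 * n) :
    latticeRep q n κ A B (fγi i) = cartanInvOp q κ (foldIdx n i) := by
  simp [latticeRep, fγi, latticeGen, hi]

lemma latticeRep_γi_of_not {i : ℕ} (hi : ¬(1 ≤ i ∧ i ≤ 2 * n)) :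
    latticeRep q n κ A B (fγi i) = 1 := by
  rw [latticeRep, fγi, FreeAlgebra.lift_ι_apply, latticeGen, if_neg hi]

lemma latticeRep_β {j : ℕ} (hj : 1 ≤ j ∧ j + 1 ≤ 2 * n) (hjn : j ≠ n) :
    latticeRep q n κ A B (fβ j) = moveOp q κ (foldIdx n j) (foldIdx n (j + 1)) := by
  rw [latticeRep, fβ, FreeAlgebra.lift_ι_apply, latticeGen, if_pos hj, if_neg hjn]

lemma latticeRep_β_self (hn : 1 ≤ n) :
    latticeRep q n κ A B (fβ n) = diagOp q A B n := by
  rw [latticeRep, fβ, FreeAlgebra.lift_ι_apply, latticeGen, if_pos (by omega), if_pos rfl]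

lemma latticeRep_β_of_not {j : ℕ} (hj : ¬(1 ≤ j ∧ j + 1 ≤ 2 * n)) :
    latticeRep q n κ A B (fβ j) = 0 := by
  rw [latticeRep, fβ, FreeAlgebra.lift_ι_apply, latticeGen, if_neg hj]

variable {q n κ A B}

lemma latticeRep_γ_β (hq : (q : ℂ) ≠ 0) {i j : ℕ} (hi : 1 ≤ i) (hi' : i ≤ 2 * n)
    (hj : 1 ≤ j) (hj' : j + 1 ≤ 2 * n) :
    latticeRep q n κ A B (fγ i * fβ j)
      = latticeRep q n κ A B (((q : ℂ) ^ (-(gex n i j))) • (fβ j * fγ i)) := by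
  rw [map_smul, map_mul, map_mul, latticeRep_γ q n κ A B ⟨hi, hi'⟩]
  by_cases hjn : j = n
  · subst hjn
    rw [latticeRep_β_self q j κ A B hj, diagOp, cartanOp_mul_wShift hq]
    congr 2
    simp only [gex, kd, Pi.zero_apply]
    split_ifs <;> omega
  · rw [latticeRep_β q n κ A B ⟨hj, hj'⟩ hjn, moveOp, cartanOp_mul_wShift hq]
    congr 2
    simp only [gex, kd, Pi.sub_apply, ev, foldIdx_eq_iff hi hi' hj (by omega : j ≤ 2 * n),
      foldIdx_eq_iff hi hi' (by omega : 1 ≤ j + 1) hj']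
    split_ifs <;> omega

lemma latticeRep_β_β (hq : (q : ℂ) ≠ 0) (hd : (q : ℂ) - (q : ℂ)⁻¹ ≠ 0) {i j : ℕ}
    (hi : 1 ≤ i) (hi' : i + 1 ≤ 2 * n) (hj : 1 ≤ j) (hj' : j + 1 ≤ 2 * n)
    (hij : i + 2 ≤ j ∨ j + 2 ≤ i) :
    latticeRep q n κ A B (fβ i * fβ j - fβ j * fβ i) = latticeRep q n κ A B
      (if i + j = 2 * n then
        ((q : ℂ) * ((q : ℂ) - (q : ℂ)⁻¹)⁻¹) • (fγi i ^ 2 - fγi (i + 1) ^ 2) else 0) := by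
  rw [map_sub, map_mul, map_mul]
  have hne {a b : ℕ} (ha : 1 ≤ a) (ha' : a ≤ 2 * n) (hb : 1 ≤ b) (hb' : b ≤ 2 * n)
      (hab : a ≠ b) (hab' : a + b ≠ 2 * n + 1) : foldIdx n a ≠ foldIdx n b := by
    rw [Ne, foldIdx_eq_iff ha ha' hb hb']
    tauto
  have hin {a : ℕ} (ha : 1 ≤ a) (ha' : a ≤ 2 * n) (h : a ≠ n) (h' : a ≠ n + 1) :
      n ≠ foldIdx n a := by
    unfold foldIdx
    split_ifs <;> omega
  by_cases h1 : i = n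
  · subst h1
    rw [if_neg (by omega), map_zero, latticeRep_β_self q i κ A B hi,
      latticeRep_β q i κ A B ⟨hj, hj'⟩ (by omega)]
    apply diagOp_comm_moveOp <;> apply hin <;> omega
  by_cases h2 : j = n
  · subst h2
    rw [if_neg (by omega), map_zero, latticeRep_β_self q j κ A B hj,
      latticeRep_β q j κ A B ⟨hi, hi'⟩ h1, ← neg_sub, neg_eq_zero]
    apply diagOp_comm_moveOp <;> apply hin <;> omega
  rw [latticeRep_β q n κ A B ⟨hi, hi'⟩ h1, latticeRep_β q n κ A B ⟨hj, hj'⟩ h2]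
  have hii : foldIdx n i ≠ foldIdx n (i + 1) := by apply hne <;> omega
  by_cases h3 : i + j = 2 * n
  · have e1 : foldIdx n j = foldIdx n (i + 1) := by
      rw [foldIdx_eq_iff] <;> omega
    have e2 : foldIdx n (j + 1) = foldIdx n i := by
      rw [foldIdx_eq_iff] <;> omega
    rw [if_pos h3, map_smul, map_sub, map_pow, map_pow, latticeRep_γi _ _ _ _ _ (by omega),
      latticeRep_γi _ _ _ _ _ (by omega), e1, e2, moveOp_commutator_swap hq hd κ hii]
  rw [if_neg h3, map_zero]
  by_cases h4 : i + j = 2 * n + 1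
  · have e1 : foldIdx n j = foldIdx n i := by
      rw [foldIdx_eq_iff] <;> omega
    rw [e1]
    apply moveOp_comm_of_same_source _ _ hii <;> apply hne <;> omega
  by_cases h5 : i + j + 1 = 2 * n
  · have e1 : foldIdx n (j + 1) = foldIdx n (i + 1) := by
      rw [foldIdx_eq_iff] <;> omega
    rw [e1]
    apply moveOp_comm_of_same_target _ _ hii <;> apply hne <;> omega
  apply moveOp_comm_of_disjoint <;> apply hne <;> omega

lemma latticeRep_serre_next (hq : (q : ℂ) ≠ 0) (hd : (q : ℂ) - (q : ℂ)⁻¹ ≠ 0)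
    (hAB : A * B = (q : ℂ) ^ (2 * (κ : ℤ))) {i : ℕ} (hi : 1 ≤ i) (hi' : i + 2 ≤ 2 * n) :
    latticeRep q n κ A B
        ((q : ℂ)⁻¹ • (fβ i ^ 2 * fβ (i+1)) - ((q : ℂ) + (q : ℂ)⁻¹) • (fβ i * fβ (i+1) * fβ i)
          + (q : ℂ) • (fβ (i+1) * fβ i ^ 2))
      = latticeRep q n κ A B (if i = n then (q : ℂ) • (fβ (n+1) * fγi n ^ 2) else 0) := by
  simp only [map_add, map_sub, map_smul, map_mul, map_pow]
  by_cases h1 : i = n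
  · subst h1
    rw [if_pos rfl, map_smul, map_mul, map_pow, latticeRep_β_self q i κ A B hi,
      latticeRep_β q i κ A B (by omega) (by omega), latticeRep_γi q i κ A B (by omega),
      foldIdx_of_le le_rfl, show foldIdx i (i + 1) = i by unfold foldIdx; split_ifs <;> omega]
    apply diagOp_serre_next hq hd hAB
    unfold foldIdx
    split_ifs <;> omega
  rw [if_neg h1, map_zero, latticeRep_β q n κ A B (by omega) h1]
  by_cases h2 : i + 1 = n
  · subst h2
    rw [latticeRep_β_self _ _ κ A B (by omega), foldIdx_of_le le_rfl, foldIdx_of_le (by omega)]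
    exact moveOp_diagOp_serre hq A B κ (by omega)
  rw [latticeRep_β q n κ A B (by omega) h2]
  apply moveOp_serre_next hq <;> rw [Ne, foldIdx_eq_iff] <;> omega

lemma latticeRep_serre_prev (hq : (q : ℂ) ≠ 0) (hd : (q : ℂ) - (q : ℂ)⁻¹ ≠ 0)
    (hAB : A * B = (q : ℂ) ^ (2 * (κ : ℤ))) {i : ℕ} (hi : 2 ≤ i) (hi' : i + 1 ≤ 2 * n) :
    latticeRep q n κ A B
        ((q : ℂ) • (fβ i ^ 2 * fβ (i-1)) - ((q : ℂ) + (q : ℂ)⁻¹) • (fβ i * fβ (i-1) * fβ i)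
          + (q : ℂ)⁻¹ • (fβ (i-1) * fβ i ^ 2))
      = latticeRep q n κ A B (if i = n then (q : ℂ)⁻¹ • (fβ (n-1) * fγi n ^ 2) else 0) := by
  obtain ⟨k, rfl⟩ : ∃ k, i = k + 1 := ⟨i - 1, by omega⟩
  simp only [map_add, map_sub, map_smul, map_mul, map_pow, Nat.add_sub_cancel]
  by_cases h1 : k + 1 = n
  · subst h1
    rw [if_pos rfl, map_smul, map_mul, map_pow, latticeRep_β_self _ _ κ A B (by omega),
      Nat.add_sub_cancel, latticeRep_β _ _ κ A B (by omega) (by omega),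
      latticeRep_γi _ _ κ A B (by omega), foldIdx_of_le le_rfl, foldIdx_of_le (by omega)]
    exact diagOp_serre_prev hq hd hAB (by omega)
  rw [if_neg h1, map_zero, latticeRep_β q n κ A B (by omega) h1]
  by_cases h2 : k = n
  · subst h2
    rw [latticeRep_β_self _ _ κ A B (by omega),
      show foldIdx k (k + 1) = k by unfold foldIdx; split_ifs <;> omega]
    apply moveOp_diagOp_serre' hq A B κ
    unfold foldIdx
    split_ifs <;> omega
  rw [latticeRep_β q n κ A B (by omega) h2]
  apply moveOp_serre_prev hq <;> rw [Ne, foldIdx_eq_iff] <;> omega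

/-- The relations of `𝒜` hold on the lattice space. -/
lemma latticeRep_eq_of_rel (hq : (q : ℂ) ≠ 0) (hd : (q : ℂ) - (q : ℂ)⁻¹ ≠ 0)
    (hAB : A * B = (q : ℂ) ^ (2 * (κ : ℤ))) {x y : AFA} (h : ARel q n x y) :
    latticeRep q n κ A B x = latticeRep q n κ A B y := by
  cases h with
  | gout i hi => rw [latticeRep_γ_of_not _ _ _ _ _ hi, map_one]
  | giout i hi => rw [latticeRep_γi_of_not _ _ _ _ _ hi, map_one]
  | bout j hj => rw [latticeRep_β_of_not _ _ _ _ _ hj, map_zero]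
  | gg i j =>
    rw [map_mul, map_mul]
    by_cases hi : 1 ≤ i ∧ i ≤ 2 * n
    · by_cases hj : 1 ≤ j ∧ j ≤ 2 * n
      · rw [latticeRep_γ _ _ _ _ _ hi, latticeRep_γ _ _ _ _ _ hj, cartanOp_comm]
      · rw [latticeRep_γ_of_not _ _ _ _ _ hj, mul_one, one_mul]
    · rw [latticeRep_γ_of_not _ _ _ _ _ hi, mul_one, one_mul]
  | ggi i =>
    rw [map_mul, map_one]
    by_cases hi : 1 ≤ i ∧ i ≤ 2 * n
    · rw [latticeRep_γ _ _ _ _ _ hi, latticeRep_γi _ _ _ _ _ hi, cartanOp_mul_cartanInvOp hq]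
    · rw [latticeRep_γ_of_not _ _ _ _ _ hi, latticeRep_γi_of_not _ _ _ _ _ hi, one_mul]
  | gig i =>
    rw [map_mul, map_one]
    by_cases hi : 1 ≤ i ∧ i ≤ 2 * n
    · rw [latticeRep_γ _ _ _ _ _ hi, latticeRep_γi _ _ _ _ _ hi, cartanInvOp_mul_cartanOp hq]
    · rw [latticeRep_γ_of_not _ _ _ _ _ hi, latticeRep_γi_of_not _ _ _ _ _ hi, one_mul]
  | gsym i hi hi' =>
    rw [latticeRep_γ _ _ _ _ _ ⟨hi, hi'⟩, latticeRep_γ _ _ _ _ _ (by omega),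
      (foldIdx_eq_iff hi hi' (by omega : 1 ≤ 2 * n + 1 - i) (by omega)).2 (by omega)]
  | gb i j hi hi' hj hj' => exact latticeRep_γ_β hq hi hi' hj hj'
  | bb i j hi hi' hj hj' hij => exact latticeRep_β_β hq hd hi hi' hj hj' hij
  | serre1 i hi hi' => exact latticeRep_serre_next hq hd hAB hi hi'
  | serre2 i hi hi' => exact latticeRep_serre_prev hq hd hAB hi hi'

end latticeRep

section compression

variable (n κ : ℕ)

/-- The inclusion of `V(κ,κ₁)` into the lattice space. -/
noncomputable def latticeIncl : Vk n κ →ₗ[ℂ] LatticeSpace :=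
  Finsupp.lmapDomain ℂ ℂ Subtype.val

/-- The projection `r_m ↦ r_m` of the lattice space onto `V(κ,κ₁)`. -/
noncomputable def latticeProj : LatticeSpace →ₗ[ℂ] Vk n κ :=
  Finsupp.lsum ℂ fun m => LinearMap.toSpanSingleton ℂ _ (rv n κ m)

/-- The compression of an operator on the lattice space to `V(κ,κ₁)`. -/
noncomputable def compress (T : Module.End ℂ LatticeSpace) : Module.End ℂ (Vk n κ) :=
  latticeProj n κ ∘ₗ T ∘ₗ latticeIncl n κ

lemma latticeIncl_injective : Function.Injective (latticeIncl n κ) :=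
  Finsupp.mapDomain_injective Subtype.val_injective

@[simp]
lemma latticeProj_single (m : ℕ → ℤ) (x : ℂ) :
    latticeProj n κ (Finsupp.single m x) = x • rv n κ m := by
  simp [latticeProj]

variable {n κ}

lemma rv_of_mOK {m : ℕ → ℤ} (h : mOK n κ m) : rv n κ m = Finsupp.single ⟨m, h⟩ 1 := dif_pos h

@[simp]
lemma latticeIncl_rv {m : ℕ → ℤ} (h : mOK n κ m) :
    latticeIncl n κ (rv n κ m) = Finsupp.single m 1 := by
  simp [latticeIncl, rv_of_mOK h]

lemma vk_hom_ext {M : Type*} [AddCommMonoid M] [Module ℂ M] {S T : Vk n κ →ₗ[ℂ] M}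
    (h : ∀ m, mOK n κ m → S (rv n κ m) = T (rv n κ m)) : S = T :=
  Finsupp.lhom_ext' fun m => LinearMap.ext_ring <| by
    simpa [rv_of_mOK m.2] using h m.1 m.2

lemma compress_one : compress n κ 1 = 1 :=
  vk_hom_ext fun m hm => by simp [compress, hm]

lemma compress_wShift_rv (c : (ℕ → ℤ) → ℂ) (v : ℕ → ℤ) {m : ℕ → ℤ} (hm : mOK n κ m) :
    compress n κ (wShift c v) (rv n κ m) = c m • rv n κ (m + v) := by
  simp [compress, hm]

lemma latticeIncl_compress_wShift {c : (ℕ → ℤ) → ℂ} {v : ℕ → ℤ}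
    (h : ∀ m, mOK n κ m → mOK n κ (m + v) ∨ c m = 0) :
    latticeIncl n κ ∘ₗ compress n κ (wShift c v) = wShift c v ∘ₗ latticeIncl n κ :=
  vk_hom_ext fun m hm => by
    rw [LinearMap.comp_apply, compress_wShift_rv _ _ hm]
    rcases h m hm with h | h <;> simp [h, hm]

lemma mOK.move {m : ℕ → ℤ} (hm : mOK n κ m) {a b : ℕ} (ha : 1 ≤ a) (ha' : a ≤ n) (hb : 1 ≤ b)
    (hb' : b ≤ n) (hma : m a ≠ 0) : mOK n κ (m + (ev b - ev a)) := by
  obtain ⟨h1, h2, h3⟩ := hm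
  refine ⟨fun i hi => ?_, fun i => ?_, ?_⟩
  · have := h1 i hi
    simp only [Pi.add_apply, Pi.sub_apply, ev]
    split_ifs <;> omega
  · have := h2 i
    simp only [Pi.add_apply, Pi.sub_apply, ev]
    split_ifs with h h' h' <;> first | omega | (subst h'; omega)
  · simp only [Pi.add_apply, Pi.sub_apply, Finset.sum_add_distrib, Finset.sum_sub_distrib, h3, ev]
    simp [ha, ha', hb, hb']

lemma latticeIncl_compress_moveOp (q : ℝ) {a b : ℕ} (ha : 1 ≤ a) (ha' : a ≤ n) (hb : 1 ≤ b)
    (hb' : b ≤ n) : latticeIncl n κ ∘ₗ compress n κ (moveOp q κ a b)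
      = moveOp q κ a b ∘ₗ latticeIncl n κ :=
  latticeIncl_compress_wShift fun m hm => by
    by_cases h : m a = 0
    · exact .inr (by simp [h, qnum])
    · exact .inl (hm.move ha ha' hb hb' h)

lemma latticeIncl_compress_latticeGen (q : ℝ) (A B : ℂ) (x : AGen) :
    latticeIncl n κ ∘ₗ compress n κ (latticeGen q n κ A B x)
      = latticeGen q n κ A B x ∘ₗ latticeIncl n κ := by
  have hdiag (c : (ℕ → ℤ) → ℂ) : latticeIncl n κ ∘ₗ compress n κ (wShift c 0)
      = wShift c 0 ∘ₗ latticeIncl n κ :=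
    latticeIncl_compress_wShift fun m hm => .inl (by simpa using hm)
  cases x with
  | g i =>
    simp only [latticeGen]
    split_ifs
    · exact hdiag _
    · rw [compress_one]; rfl
  | gi i =>
    simp only [latticeGen]
    split_ifs
    · exact hdiag _
    · rw [compress_one]; rfl
  | b j =>
    simp only [latticeGen]
    split_ifs with h1 h2
    · exact hdiag _
    · apply latticeIncl_compress_moveOp <;> unfold foldIdx <;> split_ifs <;> omega
    · simp [compress]

/-- The free algebra acting on `V(κ,κ₁)`. -/
noncomputable def vkRep (q : ℝ) (n κ : ℕ) (A B : ℂ) : AFA →ₐ[ℂ] Module.End ℂ (Vk n κ) :=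
  FreeAlgebra.lift ℂ fun x => compress n κ (latticeGen q n κ A B x)

lemma latticeIncl_vkRep (q : ℝ) (A B : ℂ) (x : AFA) :
    latticeIncl n κ ∘ₗ vkRep q n κ A B x = latticeRep q n κ A B x ∘ₗ latticeIncl n κ := by
  induction x using FreeAlgebra.induction with
  | grade0 r =>
    rw [AlgHom.commutes, AlgHom.commutes]
    refine LinearMap.ext fun v => ?_
    simp [Algebra.algebraMap_eq_smul_one]
  | grade1 x =>
    simpa [vkRep, latticeRep] using latticeIncl_compress_latticeGen q A B x
  | mul x y hx hy =>
    rw [map_mul, map_mul, Module.End.mul_eq_comp, Module.End.mul_eq_comp, ← LinearMap.comp_assoc,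
      hx, LinearMap.comp_assoc, hy, LinearMap.comp_assoc]
  | add x y hx hy =>
    rw [map_add, map_add, LinearMap.comp_add, LinearMap.add_comp, hx, hy]

lemma vkRep_eq_of_rel {q : ℝ} {A B : ℂ} (hq : (q : ℂ) ≠ 0) (hd : (q : ℂ) - (q : ℂ)⁻¹ ≠ 0)
    (hAB : A * B = (q : ℂ) ^ (2 * (κ : ℤ))) {x y : AFA} (h : ARel q n x y) :
    vkRep q n κ A B x = vkRep q n κ A B y := by
  have : latticeIncl n κ ∘ₗ vkRep q n κ A B x = latticeIncl n κ ∘ₗ vkRep q n κ A B y := by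
    rw [latticeIncl_vkRep, latticeIncl_vkRep, latticeRep_eq_of_rel hq hd hAB h]
  exact (LinearMap.cancel_left (latticeIncl_injective n κ)).1 this

end compression

section uniqueness

variable {q : ℝ} {n : ℕ}

lemma mkAlgHom_eq_of_rel {x y : AFA} (h : ARel q n x y) :
    RingQuot.mkAlgHom ℂ (ARel q n) x = RingQuot.mkAlgHom ℂ (ARel q n) y :=
  RingQuot.mkAlgHom_rel ℂ h

lemma aγ_mul_aγi (i : ℕ) : aγ q n i * aγi q n i = 1 := by
  simpa [aγ, aγi] using mkAlgHom_eq_of_rel (ARel.ggi (q := q) (n := n) i)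

lemma aγi_mul_aγ (i : ℕ) : aγi q n i * aγ q n i = 1 := by
  simpa [aγ, aγi] using mkAlgHom_eq_of_rel (ARel.gig (q := q) (n := n) i)

lemma aγ_symm {i : ℕ} (hi : 1 ≤ i) (hi' : i ≤ 2 * n) : aγ q n i = aγ q n (2 * n + 1 - i) :=
  mkAlgHom_eq_of_rel (ARel.gsym i hi hi')

lemma aγ_of_not {i : ℕ} (hi : ¬(1 ≤ i ∧ i ≤ 2 * n)) : aγ q n i = 1 := by
  simpa [aγ] using mkAlgHom_eq_of_rel (ARel.gout (q := q) i hi)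

lemma aβ_of_not {j : ℕ} (hj : ¬(1 ≤ j ∧ j + 1 ≤ 2 * n)) : aβ q n j = 0 := by
  simpa [aβ] using mkAlgHom_eq_of_rel (ARel.bout (q := q) j hj)

/-- An algebra homomorphism out of `𝒜` is determined by the images of the `γ_i` and `β_j`. -/
lemma aalg_hom_ext {R : Type*} [Ring R] [Algebra ℂ R] {f g : Aalg q n →ₐ[ℂ] R}
    (hγ : ∀ i, 1 ≤ i → i ≤ n → f (aγ q n i) = g (aγ q n i))
    (hβ : ∀ j, 1 ≤ j → j + 1 ≤ 2 * n → f (aβ q n j) = g (aβ q n j)) : f = g := by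
  have hγ' (i : ℕ) : f (aγ q n i) = g (aγ q n i) := by
    by_cases hi : 1 ≤ i ∧ i ≤ 2 * n
    · by_cases hin : i ≤ n
      · exact hγ i hi.1 hin
      · rw [aγ_symm hi.1 hi.2]
        exact hγ _ (by omega) (by omega)
    · rw [aγ_of_not hi, map_one, map_one]
  have hγi (i : ℕ) : f (aγi q n i) = g (aγi q n i) := by
    refine left_inv_eq_right_inv (a := f (aγ q n i)) ?_ ?_
    · rw [← map_mul, aγi_mul_aγ, map_one]
    · rw [hγ', ← map_mul, aγ_mul_aγi, map_one]
  have hβ' (j : ℕ) : f (aβ q n j) = g (aβ q n j) := by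
    by_cases hj : 1 ≤ j ∧ j + 1 ≤ 2 * n
    · exact hβ j hj.1 hj.2
    · rw [aβ_of_not hj, map_zero, map_zero]
  refine RingQuot.ringQuot_ext' ℂ _ _ (FreeAlgebra.hom_ext (funext fun x => ?_))
  cases x with
  | g i => exact hγ' i
  | gi i => exact hγi i
  | b j => exact hβ' j

lemma repOK_unique {σ : ℝ} {κ : ℕ} {κ₁ : ℤ} {ρ τ : Aalg q n →ₐ[ℂ] Module.End ℂ (Vk n κ)}
    (hρ : repOK q σ n κ κ₁ ρ) (hτ : repOK q σ n κ κ₁ τ) : ρ = τ := by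
  refine aalg_hom_ext (R := Module.End ℂ (Vk n κ))
    (fun i hi hi' => vk_hom_ext fun m hm => ?_) fun j hj hj' => vk_hom_ext fun m hm => ?_
  · rw [((hρ m hm).1 i hi hi').1, ((hτ m hm).1 i hi hi').1]
  · rcases lt_trichotomy j n with h | rfl | h
    · rw [((hρ m hm).2.1 j hj h).1, ((hτ m hm).2.1 j hj h).1]
    · rw [(hρ m hm).2.2, (hτ m hm).2.2]
    · obtain ⟨k, hk, hk', rfl⟩ : ∃ k, 1 ≤ k ∧ k + 1 ≤ n ∧ j = 2 * n - k :=
        ⟨2 * n - j, by omega, by omega, by omega⟩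
      rw [((hρ m hm).2.1 k hk hk').2, ((hτ m hm).2.1 k hk hk').2]

end uniqueness

section existence

variable {q : ℝ} (n κ : ℕ) {A B : ℂ} (hq : (q : ℂ) ≠ 0) (hd : (q : ℂ) - (q : ℂ)⁻¹ ≠ 0)
  (hAB : A * B = (q : ℂ) ^ (2 * (κ : ℤ)))

/-- The representation of `𝒜` on `V(κ,κ₁)` for which `β_n` has the eigenvalue
`(A q^{-2m_n} - B)/(q-q⁻¹)` on `r_m`. -/
noncomputable def aalgRep : Aalg q n →ₐ[ℂ] Module.End ℂ (Vk n κ) :=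
  RingQuot.liftAlgHom ℂ ⟨vkRep q n κ A B, fun _ _ h => vkRep_eq_of_rel hq hd hAB h⟩

lemma aalgRep_mk_ι (x : AGen) :
    aalgRep n κ hq hd hAB (RingQuot.mkAlgHom ℂ (ARel q n) (FreeAlgebra.ι ℂ x))
      = compress n κ (latticeGen q n κ A B x) := by
  rw [aalgRep, RingQuot.liftAlgHom_mkAlgHom_apply, vkRep, FreeAlgebra.lift_ι_apply]

lemma aalgRep_repOK (hn : 1 ≤ n) (σ : ℝ) (κ₁ : ℤ)
    (hdiag : ∀ t : ℤ, (A * (q : ℂ) ^ (-(2 * t)) - B) / ((q : ℂ) - (q : ℂ)⁻¹)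
      = (((q ^ (-σ + 2*((κ : ℝ) - (κ₁ : ℝ) - (t : ℝ)))
            - q ^ (σ + 2*(κ₁ : ℝ))) / (q - q⁻¹) : ℝ) : ℂ)) :
    repOK q σ n κ κ₁ (aalgRep n κ hq hd hAB) := by
  refine fun m hm => ⟨fun i hi hi' => ⟨?_, ?_, ?_⟩, fun j hj hj' => ⟨?_, ?_⟩, ?_⟩
  · rw [aγ, fγ, aalgRep_mk_ι, latticeGen, if_pos (by omega), foldIdx_of_le hi', cartanOp,
      compress_wShift_rv _ _ hm, add_zero]
  · rw [aγi, fγi, aalgRep_mk_ι, latticeGen, if_pos (by omega), foldIdx_of_le hi', cartanInvOp,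
      compress_wShift_rv _ _ hm, add_zero]
  · rw [← aγ_symm hi (by omega)]
  · rw [aβ, fβ, aalgRep_mk_ι, latticeGen, if_pos (by omega), if_neg (by omega),
      foldIdx_of_le (by omega), foldIdx_of_le hj', moveOp, compress_wShift_rv _ _ hm]
    congr 2
    funext t
    simp only [Pi.add_apply, Pi.sub_apply]
    ring
  · rw [aβ, fβ, aalgRep_mk_ι, latticeGen, if_pos (by omega), if_neg (by omega),
      foldIdx_of_lt (by omega), foldIdx_of_lt (by omega), moveOp, compress_wShift_rv _ _ hm,
      show 2 * n + 1 - (2 * n - j) = j + 1 by omega,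
      show 2 * n + 1 - (2 * n - j + 1) = j by omega]
    congr 2
    funext t
    simp only [Pi.add_apply, Pi.sub_apply]
    ring
  · rw [aβ, fβ, aalgRep_mk_ι, latticeGen, if_pos (by omega), if_pos rfl, diagOp,
      compress_wShift_rv _ _ hm, add_zero, hdiag]

end existence

end QG

open QG in
/-- There is a unique algebra homomorphism `ρ(κ,κ₁)_σ : 𝒜 → End_ℂ(V(κ,κ₁))` acting on
the basis vectors `r_m` (`m ∈ J_κ`) by the indicated formulas. -/
theorem statement_9 (q : ℝ) (hq0 : 0 < q) (hq1 : q < 1) (n : ℕ) (hn : 1 ≤ n)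
    (σ : ℝ) (κ : ℕ) (κ₁ : ℤ) :
    ∃! ρ : Aalg q n →ₐ[ℂ] Module.End ℂ (Vk n κ), repOK q σ n κ κ₁ ρ := by
  have hq : (q : ℂ) ≠ 0 := by exact_mod_cast hq0.ne'
  have hd := sub_inv_ne_zero_of_mem_Ioo hq0 hq1
  have hAB : ((q ^ (-σ + 2 * ((κ : ℝ) - κ₁)) : ℝ) : ℂ) * ((q ^ (σ + 2 * (κ₁ : ℝ)) : ℝ) : ℂ)
      = (q : ℂ) ^ (2 * (κ : ℤ)) := by
    rw [← Complex.ofReal_mul, ← Real.rpow_add hq0,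
      show -σ + 2 * ((κ : ℝ) - κ₁) + (σ + 2 * κ₁) = ((2 * (κ : ℤ) : ℤ) : ℝ) by push_cast; ring,
      Real.rpow_intCast, Complex.ofReal_zpow]
  have hρ := aalgRep_repOK n κ hq hd hAB hn σ κ₁ fun t => by
    have hexp : q ^ (-σ + 2 * ((κ : ℝ) - κ₁ - t))
        = q ^ (-σ + 2 * ((κ : ℝ) - κ₁)) * q ^ (-(2 * t)) := by
      rw [← Real.rpow_intCast, ← Real.rpow_add hq0]
      push_cast
      ring_nf
    rw [hexp]
    push_cast
    rfl
  exact ⟨_, hρ, fun τ hτ => repOK_unique hτ hρ⟩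
end

section
/- V(κ,κ_1) is a simple 𝒜-module under ρ(κ,κ_1)_σ: the only subspaces of V(κ,κ_1) invariant under all operators ρ(κ,κ_1)_σ(a), a ∈ 𝒜, are 0 and V(κ,κ_1). Moreover the subspace {v ∈ V(κ,κ_1) : ρ(κ,κ_1)_σ(γ_i) v = v for i = 1,…,n} is one-dimensional, spanned by r_{(κ,κ,…,κ)}. -/
namespace QG

variable {q σ : ℝ} {n κ : ℕ} {κ₁ : ℤ} {ρ : Aalg q n →ₐ[ℂ] Module.End ℂ (Vk n κ)}

lemma rv_coe (m : {m : ℕ → ℤ // mOK n κ m}) : rv n κ m.1 = Finsupp.single m 1 := by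
  simp [rv, m.2]

lemma zpow_ofReal_inj (hq0 : 0 < q) (hq1 : q < 1) {a b : ℤ} :
    (q : ℂ) ^ a = (q : ℂ) ^ b ↔ a = b := by
  rw [← Complex.ofReal_zpow, ← Complex.ofReal_zpow, Complex.ofReal_inj,
    zpow_right_inj₀ hq0 hq1.ne]

lemma qnum_ne_zero (hq0 : 0 < q) (hq1 : q < 1) {a : ℤ} (ha : a ≠ 0) : qnum q a ≠ 0 := by
  refine div_ne_zero (sub_ne_zero.2 fun h => ?_) (sub_ne_zero.2 fun h => ?_)
  · have := (zpow_ofReal_inj hq0 hq1).1 h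
    omega
  · rw [← zpow_one (q : ℂ), ← zpow_neg] at h
    have := (zpow_ofReal_inj hq0 hq1).1 h
    omega

/-- The operators `ρ(γ_i)` are diagonal in the basis `r_m`. -/
lemma repOK.gamma_apply (hρ : repOK q σ n κ κ₁ ρ) {i : ℕ} (hi : 1 ≤ i) (hin : i ≤ n)
    (v : Vk n κ) (m : {m : ℕ → ℤ // mOK n κ m}) :
    ρ (aγ q n i) v m = (q : ℂ) ^ (m.1 i - (κ : ℤ)) * v m := by
  classical
  induction v using Finsupp.induction_linear with
  | zero => simp
  | add f g hf hg => simp [hf, hg, mul_add]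
  | single m' c =>
    have h := ((hρ m'.1 m'.2).1 i hi hin).1
    rw [rv_coe] at h
    have hc : (Finsupp.single m' c : Vk n κ) = c • Finsupp.single m' 1 := by simp
    rw [hc, map_smul, h]
    simp only [Finsupp.smul_apply, smul_eq_mul, Finsupp.single_apply]
    split_ifs with hm
    · subst hm; ring
    · simp

lemma mOK.exists_ne {m m' : ℕ → ℤ} (hm : mOK n κ m) (hm' : mOK n κ m') (h : m ≠ m') :
    ∃ i, 1 ≤ i ∧ i ≤ n ∧ m i ≠ m' i := by
  obtain ⟨i, hi⟩ := Function.ne_iff.1 h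
  by_cases hout : i = 0 ∨ n < i
  · exact absurd ((hm.1 i hout).trans (hm'.1 i hout).symm) hi
  · exact ⟨i, by omega, by omega, hi⟩

/-- An invariant subspace contains every basis vector occurring in one of its elements. -/
lemma repOK.single_mem (hq0 : 0 < q) (hq1 : q < 1) (hρ : repOK q σ n κ κ₁ ρ)
    {p : Submodule ℂ (Vk n κ)} (hp : ∀ (a : Aalg q n) (v : Vk n κ), v ∈ p → ρ a v ∈ p)
    (m : {m : ℕ → ℤ // mOK n κ m}) (v : Vk n κ) (hv : v ∈ p) (hvm : v m ≠ 0) :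
    rv n κ m.1 ∈ p := by
  induction hk : v.support.card using Nat.strong_induction_on generalizing v with
  | _ k ih =>
    by_cases h : ∃ m' ∈ v.support, m' ≠ m
    · obtain ⟨m', hsupp, hne⟩ := h
      obtain ⟨i, hi, hin, hmi⟩ := m'.2.exists_ne m.2 (fun h => hne (Subtype.ext h))
      have hw : ∀ x, (ρ (aγ q n i) v - (q : ℂ) ^ (m'.1 i - (κ : ℤ)) • v) x
          = ((q : ℂ) ^ (x.1 i - (κ : ℤ)) - (q : ℂ) ^ (m'.1 i - (κ : ℤ))) * v x := fun x => by
        simp [hρ.gamma_apply hi hin, sub_mul]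
      refine ih _ ?_ _ (p.sub_mem (hp (aγ q n i) v hv)
        (p.smul_mem ((q : ℂ) ^ (m'.1 i - (κ : ℤ))) hv)) ?_ rfl
      · rw [← hk]
        refine Finset.card_lt_card (Finset.ssubset_iff_subset_ne.2 ⟨fun x hx => ?_, fun h => ?_⟩)
        · rw [Finsupp.mem_support_iff, hw] at hx
          exact Finsupp.mem_support_iff.2 (right_ne_zero_of_mul hx)
        · rw [← h, Finsupp.mem_support_iff, hw] at hsupp
          simp at hsupp
      · rw [hw]
        refine mul_ne_zero (sub_ne_zero.2 fun h => hmi ?_) hvm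
        have := (zpow_ofReal_inj hq0 hq1).1 h
        omega
    · push Not at h
      have : v = v m • rv n κ m.1 := by
        ext x
        rw [rv_coe]
        by_cases hx : x = m
        · simp [hx]
        · have : v x = 0 := by
            by_contra h0
            exact hx (h x (Finsupp.mem_support_iff.2 h0))
          simp [this, Ne.symm hx]
      rw [this] at hv
      exact (p.smul_mem_iff hvm).1 hv

lemma sum_mul_add_ev_sub_ev {j : ℕ} (hj : 1 ≤ j) (hjn : j + 1 ≤ n) (f m : ℕ → ℤ) :
    ∑ i ∈ Finset.Icc 1 n, f i * (m i + ev j i - ev (j + 1) i)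
      = ∑ i ∈ Finset.Icc 1 n, f i * m i + f j - f (j + 1) := by
  simp only [mul_sub, mul_add, Finset.sum_sub_distrib, Finset.sum_add_distrib, ev, mul_ite,
    mul_one, mul_zero, Finset.sum_ite_eq', Finset.mem_Icc]
  rw [if_pos (by omega), if_pos (by omega)]

lemma mOK.add_ev_sub_ev {m : ℕ → ℤ} (hm : mOK n κ m) {j : ℕ} (hj : 1 ≤ j) (hjn : j + 1 ≤ n)
    (hpos : m (j + 1) ≠ 0) : mOK n κ (fun t => m t + ev j t - ev (j + 1) t) := by
  refine ⟨fun i hi => ?_, fun i => ?_, ?_⟩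
  · have := hm.1 i hi
    simp only [ev]
    split_ifs <;> omega
  · have := hm.2.1 i
    simp only [ev]
    split_ifs with h1 h2 h2
    · omega
    · omega
    · subst h2; omega
    · omega
  · have := sum_mul_add_ev_sub_ev hj hjn (fun _ => 1) m
    simp only [one_mul] at this
    rw [this, hm.2.2]
    ring

/-- Moving one unit from position `j + 1` to position `j` does not affect membership of `r_m` in
an invariant subspace. -/
lemma repOK.rv_mem_iff (hq0 : 0 < q) (hq1 : q < 1) (hρ : repOK q σ n κ κ₁ ρ)
    {p : Submodule ℂ (Vk n κ)} (hp : ∀ (a : Aalg q n) (v : Vk n κ), v ∈ p → ρ a v ∈ p)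
    {m : ℕ → ℤ} (hm : mOK n κ m) {j : ℕ} (hj : 1 ≤ j) (hjn : j + 1 ≤ n) (hpos : m (j + 1) ≠ 0) :
    rv n κ (fun t => m t + ev j t - ev (j + 1) t) ∈ p ↔ rv n κ m ∈ p := by
  have hq : (q : ℂ) ≠ 0 := by exact_mod_cast hq0.ne'
  constructor <;> intro h
  · have hm' := hm.add_ev_sub_ev hj hjn hpos
    have h1 := hp (aβ q n j) _ h
    rw [((hρ _ hm').2.1 j hj hjn).1, p.smul_mem_iff] at h1
    · convert h1 using 2
      ext t
      ring
    · refine mul_ne_zero (zpow_ne_zero _ hq) (qnum_ne_zero hq0 hq1 ?_)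
      have := hm.2.1 j
      simp [ev]
      omega
  · have h1 := hp (aβ q n (2 * n - j)) _ h
    rwa [((hρ _ hm).2.1 j hj hjn).2, p.smul_mem_iff] at h1
    exact mul_ne_zero (zpow_ne_zero _ hq) (qnum_ne_zero hq0 hq1 hpos)

lemma mOK.eq_of_forall_eq_zero {m : ℕ → ℤ} (hn : 1 ≤ n) (hm : mOK n κ m)
    (h : ∀ j, 1 ≤ j → j + 1 ≤ n → m (j + 1) = 0) :
    m = fun t => if t = 1 then (n : ℤ) * κ else 0 := by
  have h0 : ∀ t, t ≠ 1 → m t = 0 := fun t ht => by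
    by_cases hout : t = 0 ∨ n < t
    · exact hm.1 t hout
    · obtain ⟨j, rfl⟩ : ∃ j, t = j + 1 := ⟨t - 1, by omega⟩
      exact h j (by omega) (by omega)
  ext t
  split_ifs with ht
  · rw [ht, ← hm.2.2]
    exact (Finset.sum_eq_single_of_mem 1 (Finset.mem_Icc.2 ⟨le_rfl, hn⟩) fun b _ => h0 b).symm
  · exact h0 t ht

/-- Membership of `r_m` in an invariant subspace does not depend on `m`. -/
lemma repOK.rv_mem_iff_top (hq0 : 0 < q) (hq1 : q < 1) (hn : 1 ≤ n) (hρ : repOK q σ n κ κ₁ ρ)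
    {p : Submodule ℂ (Vk n κ)} (hp : ∀ (a : Aalg q n) (v : Vk n κ), v ∈ p → ρ a v ∈ p)
    (m : ℕ → ℤ) (hm : mOK n κ m) :
    rv n κ m ∈ p ↔ rv n κ (fun t => if t = 1 then (n : ℤ) * κ else 0) ∈ p := by
  induction hk : (∑ i ∈ Finset.Icc 1 n, (i : ℤ) * m i).toNat using Nat.strong_induction_on
    generalizing m with
  | _ k ih =>
    by_cases h : ∀ j, 1 ≤ j → j + 1 ≤ n → m (j + 1) = 0
    · rw [← hm.eq_of_forall_eq_zero hn h]
    · push Not at h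
      obtain ⟨j, hj, hjn, hpos⟩ := h
      have hm' := hm.add_ev_sub_ev hj hjn hpos
      rw [← hρ.rv_mem_iff hq0 hq1 hp hm hj hjn hpos]
      refine ih _ ?_ _ hm' rfl
      have hs := sum_mul_add_ev_sub_ev hj hjn (fun i => (i : ℤ)) m
      have hnn : 0 ≤ ∑ i ∈ Finset.Icc 1 n, (i : ℤ) * (m i + ev j i - ev (j + 1) i) :=
        Finset.sum_nonneg fun i _ => mul_nonneg (by positivity) (hm'.2.1 i)
      push_cast at hs
      omega

lemma mOK_const (n κ : ℕ) : mOK n κ (fun t => if 1 ≤ t ∧ t ≤ n then (κ : ℤ) else 0) := by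
  refine ⟨fun i hi => if_neg (by omega), fun i => ?_, ?_⟩
  · dsimp only
    split_ifs <;> omega
  · rw [Finset.sum_congr rfl fun i hi => if_pos (Finset.mem_Icc.1 hi)]
    simp

end QG

open QG in
/-- `V(κ,κ₁)` is a simple `𝒜`-module under `ρ(κ,κ₁)_σ`, and the subspace of vectors
fixed by all `ρ(γ_i)` (`i = 1,…,n`) is one-dimensional, spanned by `r_{(κ,…,κ)}`. -/
theorem statement_10 (q : ℝ) (hq0 : 0 < q) (hq1 : q < 1) (n : ℕ) (hn : 1 ≤ n)
    (σ : ℝ) (κ : ℕ) (κ₁ : ℤ)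
    (ρ : Aalg q n →ₐ[ℂ] Module.End ℂ (Vk n κ)) (hρ : repOK q σ n κ κ₁ ρ) :
    (∀ p : Submodule ℂ (Vk n κ),
      (∀ (a : Aalg q n) (v : Vk n κ), v ∈ p → ρ a v ∈ p) → p = ⊥ ∨ p = ⊤) ∧
    (∀ v : Vk n κ,
      (∀ i, 1 ≤ i → i ≤ n → ρ (aγ q n i) v = v) ↔
      ∃ c : ℂ, v = c • rv n κ (fun t => if 1 ≤ t ∧ t ≤ n then (κ : ℤ) else 0)) := by
  refine ⟨fun p hp => or_iff_not_imp_left.2 fun hbot => ?_, fun v => ⟨fun hv => ?_, ?_⟩⟩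
  · obtain ⟨v, hv, hv0⟩ := p.ne_bot_iff.1 hbot
    obtain ⟨m, hm⟩ := Finsupp.ne_iff.1 hv0
    have htop := (hρ.rv_mem_iff_top hq0 hq1 hn hp _ m.2).1 (hρ.single_mem hq0 hq1 hp m v hv hm)
    refine Submodule.eq_top_iff'.2 fun w => ?_
    induction w using Finsupp.induction_linear with
    | zero => exact p.zero_mem
    | add f g hf hg => exact p.add_mem hf hg
    | single x c =>
      have hx := p.smul_mem c ((hρ.rv_mem_iff_top hq0 hq1 hn hp _ x.2).2 htop)
      simpa [rv_coe] using hx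
  · refine ⟨v ⟨_, mOK_const n κ⟩, ?_⟩
    ext x
    rw [rv_coe ⟨_, mOK_const n κ⟩, Finsupp.smul_apply, smul_eq_mul]
    by_cases hx : x = ⟨_, mOK_const n κ⟩
    · simp [hx]
    · rw [Finsupp.single_eq_of_ne hx, mul_zero]
      obtain ⟨i, hi, hin, hne⟩ :=
        x.2.exists_ne (mOK_const n κ) (fun h => hx (Subtype.ext h))
      rw [if_pos ⟨hi, hin⟩] at hne
      have h := hρ.gamma_apply hi hin v x
      rw [hv i hi hin] at h
      by_contra h0
      have h1 : (q : ℂ) ^ (x.1 i - (κ : ℤ)) = (q : ℂ) ^ (0 : ℤ) := by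
        rw [zpow_zero]
        exact mul_right_cancel₀ h0 (by rw [one_mul, ← h])
      have := (zpow_ofReal_inj hq0 hq1).1 h1
      omega
  · rintro ⟨c, rfl⟩ i hi hin
    rw [map_smul, ((hρ _ (mOK_const n κ)).1 i hi hin).1]
    simp [hi, hin]
end

section
/- Fix σ ∈ ℝ, let L be as in the context (with highest weight vector v_λ), and let M be any left 𝒜_σ-module. Then the map from Hom_{𝒜_σ}(L, M) (the space of 𝒜_σ-module homomorphisms from L, regarded as an 𝒜_σ-module by restriction, to M) to M given by φ ↦ φ(v_λ) is injective, and its image is contained in M_{λ^♭}. Similarly, if instead L contains a nonzero vector w with K_i w = q^{μ_i} w for all i (some μ ∈ ℤ^{2n}), y_j w = 0 for all j, and L is spanned by the vectors x_{j_1}⋯x_{j_r} w (r ≥ 0), then φ ↦ φ(w) is injective on Hom_{𝒜_σ}(L, M) with image contained in M_{μ^♭}. -/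
namespace QG

variable {q : ℝ} {m : ℕ}

lemma uK_mul_uE {i j : ℕ} (hi : 1 ≤ i) (him : i ≤ m) (hj : 1 ≤ j) (hjm : j + 1 ≤ m) :
    uK q m i * uE q m j = ((q : ℂ) ^ (kd i j - kd i (j+1))) • (uE q m j * uK q m i) := by
  simpa [uK, uE] using RingQuot.mkAlgHom_rel ℂ (Rel.KE (q := q) i j hi him hj hjm)

lemma uK_mul_uF {i j : ℕ} (hi : 1 ≤ i) (him : i ≤ m) (hj : 1 ≤ j) (hjm : j + 1 ≤ m) :
    uK q m i * uF q m j = ((q : ℂ) ^ (kd i (j+1) - kd i j)) • (uF q m j * uK q m i) := by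
  simpa [uK, uF] using RingQuot.mkAlgHom_rel ℂ (Rel.KF (q := q) i j hi him hj hjm)

lemma uKi_mul_uK (i : ℕ) : uKi q m i * uK q m i = 1 := by
  simpa [uK, uKi] using RingQuot.mkAlgHom_rel ℂ (Rel.KiK (q := q) (m := m) i)

lemma uE_mul_uF_sub {i j : ℕ} (hi : 1 ≤ i) (him : i + 1 ≤ m) (hj : 1 ≤ j) (hjm : j + 1 ≤ m) :
    uE q m i * uF q m j - uF q m j * uE q m i =
      if i = j then ((q : ℂ) - (q : ℂ)⁻¹)⁻¹ •
        (uK q m i * uKi q m (i+1) - uKi q m i * uK q m (i+1)) else 0 := by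
  have h := RingQuot.mkAlgHom_rel ℂ (Rel.EF (q := q) i j hi him hj hjm)
  split_ifs at h ⊢ <;> simpa [uK, uKi, uE, uF] using h

variable {L : Type} [AddCommGroup L] [Module ℂ L] (ρ : Uq q m →ₐ[ℂ] Module.End ℂ L)

/-- A simultaneous eigenvector of the `K_i`, with nonzero eigenvalues. -/
def IsWeight (z : L) : Prop :=
  ∀ i, 1 ≤ i → i ≤ m → ∃ c : ℂ, c ≠ 0 ∧ ρ (uK q m i) z = c • z

variable {ρ} {z : L}

lemma IsWeight.of_commute {x : Uq q m} (hz : IsWeight ρ z)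
    (hx : ∀ i, 1 ≤ i → i ≤ m → ∃ c : ℂ, c ≠ 0 ∧ uK q m i * x = c • (x * uK q m i)) :
    IsWeight ρ (ρ x z) := by
  intro i hi him
  obtain ⟨c, hc, hcz⟩ := hz i hi him
  obtain ⟨d, hd, hdx⟩ := hx i hi him
  refine ⟨d * c, mul_ne_zero hd hc, ?_⟩
  rw [← Module.End.mul_apply, ← map_mul, hdx]
  simp [hcz, smul_smul]

lemma IsWeight.uE (hq : q ≠ 0) (hz : IsWeight ρ z) {j : ℕ} (hj : 1 ≤ j) (hjm : j + 1 ≤ m) :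
    IsWeight ρ (ρ (uE q m j) z) :=
  hz.of_commute fun _ hi him =>
    ⟨_, zpow_ne_zero _ (Complex.ofReal_ne_zero.2 hq), uK_mul_uE hi him hj hjm⟩

lemma IsWeight.uF (hq : q ≠ 0) (hz : IsWeight ρ z) {j : ℕ} (hj : 1 ≤ j) (hjm : j + 1 ≤ m) :
    IsWeight ρ (ρ (uF q m j) z) :=
  hz.of_commute fun _ hi him =>
    ⟨_, zpow_ne_zero _ (Complex.ofReal_ne_zero.2 hq), uK_mul_uF hi him hj hjm⟩

lemma IsWeight.exists_uKi (hz : IsWeight ρ z) {i : ℕ} (hi : 1 ≤ i) (him : i ≤ m) :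
    ∃ c : ℂ, c ≠ 0 ∧ ρ (uKi q m i) z = c • z := by
  obtain ⟨c, hc, hcz⟩ := hz i hi him
  refine ⟨c⁻¹, inv_ne_zero hc, ?_⟩
  have h : ρ (uKi q m i) (ρ (uK q m i) z) = z := by
    rw [← Module.End.mul_apply, ← map_mul, uKi_mul_uK, map_one, Module.End.one_apply]
  rw [hcz, map_smul] at h
  rw [eq_inv_smul_iff₀ hc, h]

lemma IsWeight.exists_uE_uF (hz : IsWeight ρ z) {i j : ℕ} (hi : 1 ≤ i) (him : i + 1 ≤ m)
    (hj : 1 ≤ j) (hjm : j + 1 ≤ m) :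
    ∃ d : ℂ, ρ (QG.uE q m i) (ρ (QG.uF q m j) z) =
      ρ (QG.uF q m j) (ρ (QG.uE q m i) z) + d • z := by
  have h := congrArg (fun x => ρ x z) (uE_mul_uF_sub (q := q) hi him hj hjm)
  obtain ⟨a, -, ha⟩ := hz i hi (by omega)
  obtain ⟨b, -, hb⟩ := hz (i + 1) (by omega) him
  obtain ⟨a', -, ha'⟩ := hz.exists_uKi hi (by omega)
  obtain ⟨b', -, hb'⟩ := hz.exists_uKi (i := i + 1) (by omega) him
  split_ifs at h with hij
  · refine ⟨((q : ℂ) - (q : ℂ)⁻¹)⁻¹ * (b' * a - b * a'), ?_⟩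
    simp only [map_sub, map_mul, map_smul, LinearMap.sub_apply, Module.End.mul_apply,
      LinearMap.smul_apply, ha, hb, ha', hb', smul_smul, ← sub_smul] at h
    rw [← h]; abel
  · refine ⟨0, ?_⟩
    simpa [sub_eq_zero] using h

/-- A submodule containing a vector `v` killed by all `Y j` contains every word in the `X j`
applied to `v`, if membership of `X k z` follows from that of `z` and `Y (τ k) z`. -/
lemma foldr_mem_of_step {P : ℕ → Prop} {wt : L → Prop} {X Y : ℕ → Module.End ℂ L} {τ : ℕ → ℕ}
    {v : L} (hv : wt v) (hYv : ∀ j, P j → Y j v = 0)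
    (hX : ∀ j z, P j → wt z → wt (X j z))
    (hYX : ∀ j k z, P j → P k → wt z → ∃ d : ℂ, Y j (X k z) = X k (Y j z) + d • z)
    (hτ : ∀ k, P k → P (τ k)) {N : Submodule ℂ L} (hvN : v ∈ N)
    (step : ∀ k z, P k → wt z → z ∈ N → Y (τ k) z ∈ N → X k z ∈ N)
    (l : List ℕ) (hl : ∀ j ∈ l, P j) : l.foldr (fun j u => X j u) v ∈ N := by
  let W : ℕ → Submodule ℂ L := fun r => Submodule.span ℂ
    {z | ∃ l : List ℕ, (∀ j ∈ l, P j) ∧ l.length ≤ r ∧ z = l.foldr (fun j u => X j u) v}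
  have hwt : ∀ l : List ℕ, (∀ j ∈ l, P j) → wt (l.foldr (fun j u => X j u) v) := by
    intro l hl
    induction l with
    | nil => exact hv
    | cons k l ih =>
      exact hX _ _ (hl k (by simp)) (ih fun j hj => hl j (List.mem_cons_of_mem _ hj))
  have hXW : ∀ k r, P k → ∀ z ∈ W r, X k z ∈ W (r + 1) := by
    intro k r hk z hz
    refine (Submodule.span_le (p := (W (r + 1)).comap (X k))).2 ?_ hz
    rintro _ ⟨l, hl, hlr, rfl⟩
    exact Submodule.subset_span
      ⟨k :: l, by simpa using ⟨hk, hl⟩, by simpa using hlr, rfl⟩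
  have hYW : ∀ j, P j → ∀ l : List ℕ, (∀ k ∈ l, P k) →
      Y j (l.foldr (fun j u => X j u) v) ∈ W l.length := by
    intro j hj l hl
    induction l with
    | nil => simp [hYv j hj]
    | cons k l ih =>
      have hk := hl k (by simp)
      have hl' : ∀ j ∈ l, P j := fun j hj => hl j (List.mem_cons_of_mem _ hj)
      obtain ⟨d, hd⟩ := hYX j k _ hj hk (hwt l hl')
      rw [List.foldr_cons, hd]
      exact add_mem (hXW _ _ hk _ (ih hl'))
        (Submodule.smul_mem _ _ (Submodule.subset_span ⟨l, hl', by simp, rfl⟩))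
  have hWN : ∀ r, W r ≤ N := by
    intro r
    induction r with
    | zero =>
      refine Submodule.span_le.2 ?_
      rintro _ ⟨l, -, hlr, rfl⟩
      rw [List.length_eq_zero_iff.1 (Nat.le_zero.1 hlr)]
      exact hvN
    | succ r ih =>
      refine Submodule.span_le.2 ?_
      rintro _ ⟨l, hl, hlr, rfl⟩
      cases l with
      | nil => exact hvN
      | cons k l =>
        have hk := hl k (by simp)
        have hl' : ∀ j ∈ l, P j := fun j hj => hl j (List.mem_cons_of_mem _ hj)
        have hlr' : l.length ≤ r := by simpa using hlr
        refine step k _ hk (hwt l hl') (ih (Submodule.subset_span ⟨l, hl', hlr', rfl⟩)) (ih ?_)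
        refine Submodule.span_mono ?_ (hYW _ (hτ k hk) l hl')
        rintro _ ⟨l₁, h₁, h₂, rfl⟩
        exact ⟨l₁, h₁, h₂.trans hlr', rfl⟩
  exact hWN l.length (Submodule.subset_span ⟨l, hl, le_rfl, rfl⟩)

variable {n : ℕ} {σ : ℝ} {ρL : Uq q (2*n) →ₐ[ℂ] Module.End ℂ L}

lemma IsWeight.exists_leading (hq : q ≠ 0) (hz : IsWeight ρL z) {j k : ℕ}
    (hj : 1 ≤ j) (hjn : j + 1 ≤ 2*n) (hk : k = 2*n - j) :
    ∃ a c : ℂ, a ≠ 0 ∧ c ≠ 0 ∧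
      ρL (QG.uF q (2*n) j * uKi q (2*n) (j+1) * uKi q (2*n) k
        + uKi q (2*n) j * QG.uE q (2*n) k * uKi q (2*n) k) z =
      a • ρL (QG.uF q (2*n) j) z + c • ρL (QG.uE q (2*n) k) z := by
  obtain ⟨a, ha, haz⟩ := hz.exists_uKi (i := j + 1) (by omega) hjn
  obtain ⟨b, hb, hbz⟩ := hz.exists_uKi (i := k) (by omega) (by omega)
  obtain ⟨c, hc, hcz⟩ := (hz.uE hq (j := k) (by omega) (by omega)).exists_uKi hj (by omega)
  refine ⟨b * a, b * c, mul_ne_zero hb ha, mul_ne_zero hb hc, ?_⟩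
  simp [haz, hbz, hcz, smul_smul]

variable {πσ : Aalg q n →ₐ[ℂ] Uq q (2*n)}

lemma IsWeight.exists_aβ (hq : q ≠ 0)
    (hπσβ : ∀ j, 1 ≤ j → j + 1 ≤ 2*n → j ≠ n → πσ (aβ q n j) = Bb q n j)
    (hπσn : πσ (aβ q n n) = Bs q σ n) (hz : IsWeight ρL z) {j : ℕ}
    (hj : 1 ≤ j) (hjn : j + 1 ≤ 2*n) :
    ∃ a c d : ℂ, a ≠ 0 ∧ c ≠ 0 ∧ ρL (πσ (aβ q n j)) z =
      a • ρL (QG.uF q (2*n) j) z + c • ρL (QG.uE q (2*n) (2*n-j)) z + d • z := by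
  obtain ⟨a, c, ha, hc, h⟩ := hz.exists_leading hq hj hjn rfl
  by_cases hjn' : j = n
  · subst hjn'
    have hk : 2 * j - j = j := by omega
    rw [hk] at h ⊢
    obtain ⟨b, -, hb⟩ := hz.exists_uKi hj (by omega)
    refine ⟨a, c, (((q ^ (-σ) - q ^ σ) / (q - q⁻¹) : ℝ) : ℂ) * (b * b), ha, hc, ?_⟩
    rw [hπσn, Bs, map_add, LinearMap.add_apply, h, map_smul, LinearMap.smul_apply, pow_two,
      map_mul, Module.End.mul_apply, hb, map_smul, hb, smul_smul, smul_smul, mul_assoc]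
  · exact ⟨a, c, 0, ha, hc, by rw [hπσβ j hj hjn hjn', Bb, h, zero_smul, add_zero]⟩

variable {M : Type} [AddCommGroup M] [Module ℂ M] {ρM : Aalg q n →ₐ[ℂ] Module.End ℂ M}

lemma map_aγ_apply_of_weight
    (hπσγ : ∀ i, 1 ≤ i → i ≤ 2*n →
      πσ (aγ q n i) = Cc q n i ∧ πσ (aγi q n i) = Ccinv q n i)
    (hq : q ≠ 0) {μ : ℕ → ℤ} {w : L}
    (hw : ∀ i, 1 ≤ i → i ≤ 2*n → ρL (uK q (2*n) i) w = ((q : ℂ) ^ (μ i)) • w)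
    {φ : L →ₗ[ℂ] M} (hφ : ∀ (a : Aalg q n) (v : L), φ (ρL (πσ a) v) = ρM a (φ v))
    {i : ℕ} (hi : 1 ≤ i) (hin : i ≤ n) :
    ρM (aγ q n i) (φ w) = ((q : ℂ) ^ (μ i + μ (2*n+1-i))) • φ w := by
  rw [← hφ, (hπσγ i hi (by omega)).1, Cc, map_mul, Module.End.mul_apply,
    hw (2*n+1-i) (by omega) (by omega), map_smul, hw i hi (by omega), smul_smul, map_smul,
    ← zpow_add₀ (Complex.ofReal_ne_zero.2 hq), add_comm]

lemma isWeight_of_zpow (hq : q ≠ 0) {μ : ℕ → ℤ} {w : L}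
    (hw : ∀ i, 1 ≤ i → i ≤ m → ρ (uK q m i) w = ((q : ℂ) ^ (μ i)) • w) : IsWeight ρ w :=
  fun i hi him => ⟨_, zpow_ne_zero _ (Complex.ofReal_ne_zero.2 hq), hw i hi him⟩

lemma apply_mem_eqLocus {φ ψ : L →ₗ[ℂ] M}
    (hφ : ∀ (a : Aalg q n) (v : L), φ (ρL (πσ a) v) = ρM a (φ v))
    (hψ : ∀ (a : Aalg q n) (v : L), ψ (ρL (πσ a) v) = ρM a (ψ v)) (a : Aalg q n)
    (hz : z ∈ LinearMap.eqLocus φ ψ) : ρL (πσ a) z ∈ LinearMap.eqLocus φ ψ := by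
  rw [LinearMap.mem_eqLocus] at hz ⊢
  rw [hφ, hψ, hz]

end QG

open QG in
/-- Expectation maps: for a highest weight module `L` (with highest weight vector `v_λ`)
and any `𝒜_σ`-module `M`, the map `φ ↦ φ(v_λ)` on `Hom_{𝒜_σ}(L,M)` is injective with
image contained in `M_{λ♭}`; similarly for a lowest weight vector `w`. Here `𝒜_σ`-modules
are presented as modules over the abstract algebra `𝒜` (via the isomorphism `π_σ`), and
`L` is regarded as an `𝒜_σ`-module by restriction along `π_σ`. -/
theorem statement_11 (q : ℝ) (hq0 : 0 < q) (hq1 : q < 1) (n : ℕ) (hn : 1 ≤ n) (σ : ℝ)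
    (πσ : Aalg q n →ₐ[ℂ] Uq q (2*n))
    (hπσγ : ∀ i, 1 ≤ i → i ≤ 2*n →
      πσ (aγ q n i) = Cc q n i ∧ πσ (aγi q n i) = Ccinv q n i)
    (hπσβ : ∀ j, 1 ≤ j → j + 1 ≤ 2*n → j ≠ n → πσ (aβ q n j) = Bb q n j)
    (hπσn : πσ (aβ q n n) = Bs q σ n)
    (L M : Type) [AddCommGroup L] [Module ℂ L] [AddCommGroup M] [Module ℂ M]
    (ρL : Uq q (2*n) →ₐ[ℂ] Module.End ℂ L)
    (ρM : Aalg q n →ₐ[ℂ] Module.End ℂ M)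
    (lam : ℕ → ℤ) (vlam : L) (hv0 : vlam ≠ 0)
    (hK : ∀ i, 1 ≤ i → i ≤ 2*n → ρL (uK q (2*n) i) vlam = ((q : ℂ) ^ (lam i)) • vlam)
    (hx : ∀ j, 1 ≤ j → j + 1 ≤ 2*n → ρL (uE q (2*n) j) vlam = 0)
    (hspan : Submodule.span ℂ
      {z : L | ∃ l : List ℕ, (∀ j ∈ l, 1 ≤ j ∧ j + 1 ≤ 2*n) ∧
        z = l.foldr (fun j u => ρL (uF q (2*n) j) u) vlam} = ⊤) :
    ((∀ φ ψ : L →ₗ[ℂ] M,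
        (∀ (a : Aalg q n) (v : L), φ (ρL (πσ a) v) = ρM a (φ v)) →
        (∀ (a : Aalg q n) (v : L), ψ (ρL (πσ a) v) = ρM a (ψ v)) →
        φ vlam = ψ vlam → φ = ψ) ∧
      (∀ φ : L →ₗ[ℂ] M,
        (∀ (a : Aalg q n) (v : L), φ (ρL (πσ a) v) = ρM a (φ v)) →
        ∀ i, 1 ≤ i → i ≤ n →
          ρM (aγ q n i) (φ vlam) = ((q : ℂ) ^ (lam i + lam (2*n+1-i))) • (φ vlam))) ∧
    (∀ (μ : ℕ → ℤ) (w : L), w ≠ 0 →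
      (∀ i, 1 ≤ i → i ≤ 2*n → ρL (uK q (2*n) i) w = ((q : ℂ) ^ (μ i)) • w) →
      (∀ j, 1 ≤ j → j + 1 ≤ 2*n → ρL (uF q (2*n) j) w = 0) →
      Submodule.span ℂ
        {z : L | ∃ l : List ℕ, (∀ j ∈ l, 1 ≤ j ∧ j + 1 ≤ 2*n) ∧
          z = l.foldr (fun j u => ρL (uE q (2*n) j) u) w} = ⊤ →
      (∀ φ ψ : L →ₗ[ℂ] M,
        (∀ (a : Aalg q n) (v : L), φ (ρL (πσ a) v) = ρM a (φ v)) →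
        (∀ (a : Aalg q n) (v : L), ψ (ρL (πσ a) v) = ρM a (ψ v)) →
        φ w = ψ w → φ = ψ) ∧
      (∀ φ : L →ₗ[ℂ] M,
        (∀ (a : Aalg q n) (v : L), φ (ρL (πσ a) v) = ρM a (φ v)) →
        ∀ i, 1 ≤ i → i ≤ n →
          ρM (aγ q n i) (φ w) = ((q : ℂ) ^ (μ i + μ (2*n+1-i))) • (φ w))) := by
  have hq : q ≠ 0 := hq0.ne'
  let P : ℕ → Prop := fun j => 1 ≤ j ∧ j + 1 ≤ 2*n
  have hP : ∀ k, P k → P (2*n - k) := by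
    intro k hk
    simp only [P] at hk ⊢
    omega
  refine ⟨⟨fun φ ψ hφ hψ hv => ?_, fun φ hφ i hi hin =>
    map_aγ_apply_of_weight hπσγ hq hK hφ hi hin⟩, fun μ w _ hw hFw hspan' =>
    ⟨fun φ ψ hφ hψ hv => ?_, fun φ hφ i hi hin =>
      map_aγ_apply_of_weight hπσγ hq hw hφ hi hin⟩⟩
  · refine LinearMap.eqLocus_eq_top.1 (top_le_iff.1 (hspan.ge.trans (Submodule.span_le.2 ?_)))
    rintro _ ⟨l, hl, rfl⟩
    refine foldr_mem_of_step (P := P) (wt := IsWeight ρL) (X := fun j => ρL (uF q (2*n) j))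
      (Y := fun j => ρL (uE q (2*n) j)) (τ := fun k => 2*n - k)
      (isWeight_of_zpow hq hK) (fun j hj => hx j hj.1 hj.2)
      (fun j z hj hz => hz.uF hq hj.1 hj.2)
      (fun j k z hj hk hz => hz.exists_uE_uF hj.1 hj.2 hk.1 hk.2) hP hv ?_ l hl
    intro k z hk hz hzN hYz
    obtain ⟨a, c, d, ha, -, h⟩ := hz.exists_aβ hq hπσβ hπσn hk.1 hk.2
    have hB := apply_mem_eqLocus hφ hψ (aβ q n k) hzN
    rw [h, Submodule.add_mem_iff_left _ (Submodule.smul_mem _ _ hzN),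
      Submodule.add_mem_iff_left _ (Submodule.smul_mem _ _ hYz)] at hB
    exact (Submodule.smul_mem_iff _ ha).1 hB
  · refine LinearMap.eqLocus_eq_top.1 (top_le_iff.1 (hspan'.ge.trans (Submodule.span_le.2 ?_)))
    rintro _ ⟨l, hl, rfl⟩
    refine foldr_mem_of_step (P := P) (wt := IsWeight ρL) (X := fun j => ρL (uE q (2*n) j))
      (Y := fun j => ρL (uF q (2*n) j)) (τ := fun k => 2*n - k)
      (isWeight_of_zpow hq hw) (fun j hj => hFw j hj.1 hj.2)
      (fun j z hj hz => hz.uE hq hj.1 hj.2) ?_ hP hv ?_ l hl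
    · intro j k z hj hk hz
      obtain ⟨d, hd⟩ := hz.exists_uE_uF hk.1 hk.2 hj.1 hj.2
      exact ⟨-d, by rw [hd, neg_smul, add_neg_cancel_right]⟩
    · intro k z hk hz hzN hYz
      have hk' := hP k hk
      obtain ⟨a, c, d, -, hc, h⟩ := hz.exists_aβ hq hπσβ hπσn hk'.1 hk'.2
      have hB := apply_mem_eqLocus hφ hψ (aβ q n (2*n - k)) hzN
      rw [h, Submodule.add_mem_iff_left _ (Submodule.smul_mem _ _ hzN),
        Submodule.add_mem_iff_right _ (Submodule.smul_mem _ _ hYz),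
        Nat.sub_sub_self (by have := hk.2; omega)] at hB
      exact (Submodule.smul_mem_iff _ hc).1 hB
end
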